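/- arXiv:1707.08453 — 7 statements merged into one kernel-verified Lean document; each statement's English description precedes it below -/
import Mathlib

section
/- Let b1,b2,b3,b4 ≥ 1 and v1,v2,v3,v4 ≥ 0 be integers with (v1,v2) ≠ (0,0) and (v3,v4) ≠ (0,0). Set n1 = b2(b3·v4 + v3·b4), n2 = b1(b3·v4 + v3·b4), n3 = b4(b1·v2 + v1·b2), n4 = b3(b1·v2 + v1·b2). If gcd(n1,n2,n3,n4) = 1, then the toric ideal I(n) equals the ideal of K[x1,x2,x3,x4] generated by the three binomials x1^{b1} − x2^{b2}, x3^{b3} − x4^{b4} and x1^{v1}x2^{v2} − x3^{v3}x4^{v4}; in particular I(n) is a complete intersection. -/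
open MvPolynomial

/-- The toric ideal of the monomial curve `(t^{n 0}, t^{n 1}, t^{n 2}, t^{n 3})`:
the kernel of the `K`-algebra map `K[x₁,x₂,x₃,x₄] → K[t]`, `xᵢ ↦ t^{n i}`. -/
noncomputable def toricIdeal (K : Type*) [Field K] (n : Fin 4 → ℕ) :
    Ideal (MvPolynomial (Fin 4) K) :=
  RingHom.ker (aeval (fun i => (Polynomial.X : Polynomial K) ^ n i) :
    MvPolynomial (Fin 4) K →ₐ[K] Polynomial K)

/-- If `x ^ b = y ^ c` with `b`, `c` coprime, then the monomials in `x`, `y` depend only on their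
degree for the grading `deg x = c`, `deg y = b`. -/
theorem pow_mul_pow_eq_of_degree_eq {M : Type*} [CommMonoid M] {x y : M} {b c : ℕ}
    (hb : 1 ≤ b) (hbc : Nat.Coprime b c) (h : x ^ b = y ^ c) {i j i' j' : ℕ}
    (hdeg : i * c + j * b = i' * c + j' * b) :
    x ^ i * y ^ j = x ^ i' * y ^ j' := by
  wlog hle : i ≤ i' generalizing i j i' j'
  · exact (this hdeg.symm (by omega)).symm
  obtain ⟨d, rfl⟩ := Nat.exists_eq_add_of_le hle
  have hd : j * b = d * c + j' * b := by linarith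
  have hdvd : b ∣ d := hbc.dvd_of_dvd_mul_right
    ((Nat.dvd_add_left (dvd_mul_left b j')).1 (hd ▸ dvd_mul_left b j))
  obtain ⟨m, rfl⟩ := hdvd
  obtain rfl : j = c * m + j' := by
    apply Nat.eq_of_mul_eq_mul_right hb
    linarith
  rw [pow_add, pow_add, pow_mul, pow_mul, h, mul_assoc]

/-- Monomials of the same degree agree as soon as the binomial relations of two coprime pairs and
the gluing relation between them hold. -/
theorem glued_monomials_eq_of_degree_eq {M : Type*} [CommMonoid M] {x y z w : M}
    {b1 b2 b3 b4 v1 v2 v3 v4 A B : ℕ}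
    (hb1 : 1 ≤ b1) (hb3 : 1 ≤ b3)
    (hA : A = b3 * v4 + v3 * b4) (hB : B = b1 * v2 + v1 * b2) (hBpos : 1 ≤ B)
    (h12 : Nat.Coprime b1 b2) (h34 : Nat.Coprime b3 b4) (hAB : Nat.Coprime A B)
    (hxy : x ^ b1 = y ^ b2) (hzw : z ^ b3 = w ^ b4)
    (hglue : x ^ v1 * y ^ v2 = z ^ v3 * w ^ v4)
    {i j k l i' j' k' l' : ℕ}
    (hdeg : (i * b2 + j * b1) * A + (k * b4 + l * b3) * B
      = (i' * b2 + j' * b1) * A + (k' * b4 + l' * b3) * B) :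
    x ^ i * y ^ j * (z ^ k * w ^ l) = x ^ i' * y ^ j' * (z ^ k' * w ^ l') := by
  wlog hle : i' * b2 + j' * b1 ≤ i * b2 + j * b1 generalizing i j k l i' j' k' l'
  · exact (this hdeg.symm (by omega)).symm
  obtain ⟨d, hd⟩ := Nat.exists_eq_add_of_le hle
  have hdA : (k' * b4 + l' * b3) * B = d * A + (k * b4 + l * b3) * B := by
    rw [hd] at hdeg
    linarith
  have hdvd : B ∣ d := hAB.symm.dvd_of_dvd_mul_right
    ((Nat.dvd_add_left (dvd_mul_left B _)).1 (hdA ▸ dvd_mul_left B _))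
  obtain ⟨m, rfl⟩ := hdvd
  have hkl : k' * b4 + l' * b3 = m * A + (k * b4 + l * b3) := by
    apply Nat.eq_of_mul_eq_mul_right hBpos
    linarith
  have hij : x ^ i * y ^ j = x ^ (i' + v1 * m) * y ^ (j' + v2 * m) := by
    apply pow_mul_pow_eq_of_degree_eq hb1 h12 hxy
    rw [hd, hB]
    ring
  have hkl' : z ^ k' * w ^ l' = z ^ (k + v3 * m) * w ^ (l + v4 * m) := by
    apply pow_mul_pow_eq_of_degree_eq hb3 h34 hzw
    rw [hkl, hA]
    ring
  have hglue' : x ^ (v1 * m) * y ^ (v2 * m) = z ^ (v3 * m) * w ^ (v4 * m) := by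
    simp only [pow_mul, ← mul_pow, hglue]
  calc x ^ i * y ^ j * (z ^ k * w ^ l)
      = x ^ i' * y ^ j' * (x ^ (v1 * m) * y ^ (v2 * m)) * (z ^ k * w ^ l) := by
        rw [hij, pow_add, pow_add, mul_mul_mul_comm (x ^ i')]
    _ = x ^ i' * y ^ j' * (z ^ k' * w ^ l') := by
        rw [hglue', hkl', pow_add, pow_add, mul_mul_mul_comm (z ^ k), mul_assoc,
          mul_comm (z ^ (v3 * m) * w ^ (v4 * m))]

/-- The toric ideal is contained in every ideal modulo which monomials of equal degree agree. -/
theorem toricIdeal_le_of_mk_monomial_eq {K : Type*} [Field K] {n : Fin 4 → ℕ}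
    {J : Ideal (MvPolynomial (Fin 4) K)}
    (h : ∀ m m' : Fin 4 →₀ ℕ, ∑ i, m i * n i = ∑ i, m' i * n i →
      Ideal.Quotient.mk J (monomial m 1) = Ideal.Quotient.mk J (monomial m' 1)) :
    toricIdeal K n ≤ J := by
  set deg : (Fin 4 →₀ ℕ) → ℕ := fun m => ∑ i, m i * n i
  set q : (Fin 4 →₀ ℕ) → MvPolynomial (Fin 4) K ⧸ J :=
    fun m => Ideal.Quotient.mk J (monomial m 1)
  let L := (Polynomial.basisMonomials K).constr K (Function.extend deg q 0)
  have hfactor : Function.FactorsThrough q deg := fun m m' => h m m'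
  have hL : L ∘ₗ (aeval (fun i => (Polynomial.X : Polynomial K) ^ n i) :
      MvPolynomial (Fin 4) K →ₐ[K] Polynomial K).toLinearMap
      = (Ideal.Quotient.mkₐ K J).toLinearMap := by
    refine MvPolynomial.linearMap_ext fun m => LinearMap.ext_ring ?_
    have hm : (aeval (fun i => (Polynomial.X : Polynomial K) ^ n i)) (monomial m (1 : K))
        = Polynomial.basisMonomials K (deg m) := by
      rw [aeval_monomial, map_one, one_mul, Finsupp.prod_fintype _ _ (by simp)]
      simp only [← pow_mul, Finset.prod_pow_eq_pow_sum, Polynomial.coe_basisMonomials,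
        Polynomial.monomial_one_right_eq_X_pow]
      exact congrArg _ (Finset.sum_congr rfl fun i _ => mul_comm _ _)
    simp only [LinearMap.comp_apply, AlgHom.toLinearMap_apply, hm, L, Module.Basis.constr_basis,
      hfactor.extend_apply]
    rfl
  intro p hp
  have hp' : aeval (fun i => (Polynomial.X : Polynomial K) ^ n i) p = 0 := hp
  have := LinearMap.congr_fun hL p
  rw [LinearMap.comp_apply, AlgHom.toLinearMap_apply, hp', map_zero] at this
  exact Ideal.Quotient.eq_zero_iff_mem.1 this.symm

theorem stmt0 (K : Type*) [Field K] (b1 b2 b3 b4 v1 v2 v3 v4 : ℕ)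
    (hb1 : 1 ≤ b1) (hb2 : 1 ≤ b2) (hb3 : 1 ≤ b3) (hb4 : 1 ≤ b4)
    (hv12 : ¬(v1 = 0 ∧ v2 = 0)) (hv34 : ¬(v3 = 0 ∧ v4 = 0))
    (n : Fin 4 → ℕ)
    (hn : n = ![b2 * (b3 * v4 + v3 * b4), b1 * (b3 * v4 + v3 * b4),
      b4 * (b1 * v2 + v1 * b2), b3 * (b1 * v2 + v1 * b2)])
    (hgcd : Nat.gcd (Nat.gcd (Nat.gcd (n 0) (n 1)) (n 2)) (n 3) = 1) :
    toricIdeal K n =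
      Ideal.span {(X 0 : MvPolynomial (Fin 4) K) ^ b1 - X 1 ^ b2,
        X 2 ^ b3 - X 3 ^ b4,
        X 0 ^ v1 * X 1 ^ v2 - X 2 ^ v3 * X 3 ^ v4} ∧
    ∃ g1 g2 g3 : MvPolynomial (Fin 4) K,
      toricIdeal K n = Ideal.span {g1, g2, g3} := by
  set A := b3 * v4 + v3 * b4 with hA
  set B := b1 * v2 + v1 * b2 with hB
  subst hn
  simp only [Matrix.cons_val] at hgcd
  have hunit : ∀ d, d ∣ b2 * A → d ∣ b1 * A → d ∣ b4 * B → d ∣ b3 * B → d = 1 :=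
    fun d h1 h2 h3 h4 =>
      Nat.dvd_one.1 (hgcd ▸ Nat.dvd_gcd (Nat.dvd_gcd (Nat.dvd_gcd h1 h2) h3) h4)
  have hAB : Nat.Coprime A B := hunit _
    ((Nat.gcd_dvd_left _ _).mul_left _) ((Nat.gcd_dvd_left _ _).mul_left _)
    ((Nat.gcd_dvd_right _ _).mul_left _) ((Nat.gcd_dvd_right _ _).mul_left _)
  have h12 : Nat.Coprime b1 b2 := by
    have hdvd : Nat.gcd b1 b2 ∣ B :=
      dvd_add ((Nat.gcd_dvd_left _ _).mul_right _) ((Nat.gcd_dvd_right _ _).mul_left _)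
    exact hunit _ ((Nat.gcd_dvd_right _ _).mul_right _) ((Nat.gcd_dvd_left _ _).mul_right _)
      (hdvd.mul_left _) (hdvd.mul_left _)
  have h34 : Nat.Coprime b3 b4 := by
    have hdvd : Nat.gcd b3 b4 ∣ A :=
      dvd_add ((Nat.gcd_dvd_left _ _).mul_right _) ((Nat.gcd_dvd_right _ _).mul_left _)
    exact hunit _ (hdvd.mul_left _) (hdvd.mul_left _)
      ((Nat.gcd_dvd_right _ _).mul_right _) ((Nat.gcd_dvd_left _ _).mul_right _)
  have hBpos : 1 ≤ B := by
    rcases Nat.eq_zero_or_pos v1 with h | h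
    · have : 1 ≤ v2 := by omega
      nlinarith
    · nlinarith
  suffices heq : toricIdeal K ![b2 * A, b1 * A, b4 * B, b3 * B] =
      Ideal.span {(X 0 : MvPolynomial (Fin 4) K) ^ b1 - X 1 ^ b2, X 2 ^ b3 - X 3 ^ b4,
        X 0 ^ v1 * X 1 ^ v2 - X 2 ^ v3 * X 3 ^ v4} from ⟨heq, _, _, _, heq⟩
  apply le_antisymm
  · apply toricIdeal_le_of_mk_monomial_eq
    intro m m' hdeg
    simp only [Fin.sum_univ_four, Matrix.cons_val] at hdeg
    simp only [monomial_eq, map_one, one_mul, Finsupp.prod_fintype _ _ (fun _ => pow_zero _),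
      Fin.prod_univ_four, map_mul, map_pow]
    rw [mul_assoc (_ * _), mul_assoc (_ * _)]
    apply glued_monomials_eq_of_degree_eq hb1 hb3 hA hB hBpos h12 h34 hAB
    · simp only [← map_pow, Ideal.Quotient.eq]
      exact Ideal.subset_span (by simp)
    · simp only [← map_pow, Ideal.Quotient.eq]
      exact Ideal.subset_span (by simp)
    · simp only [← map_pow, ← map_mul, Ideal.Quotient.eq]
      exact Ideal.subset_span (by simp)
    · linarith
  · rw [Ideal.span_le]
    rintro p (rfl | rfl | rfl) <;>
      simp only [toricIdeal, SetLike.mem_coe, RingHom.mem_ker, map_sub, map_mul, map_pow, aeval_X,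
        Matrix.cons_val, ← pow_mul, ← pow_add, sub_eq_zero]
    · ring_nf
    · ring_nf
    · congr 1
      rw [hA, hB]
      ring
end

section
/- Let b1,b2,b3,b4 ≥ 1 and c1,c2,m1,m2,m3 ≥ 0 be integers with (c1,c2) ≠ (0,0) and (m1,m2,m3) ≠ (0,0,0). Set n1 = b2·b3·b4, n2 = b1·b3·b4, n3 = b4(b1·c2 + c1·b2), n4 = m3(b1·c2 + b2·c1) + b3(b1·m2 + m1·b2). If gcd(n1,n2,n3,n4) = 1, then the toric ideal I(n) equals the ideal of K[x1,x2,x3,x4] generated by the three binomials x1^{b1} − x2^{b2}, x3^{b3} − x1^{c1}x2^{c2} and x4^{b4} − x1^{m1}x2^{m2}x3^{m3}; in particular I(n) is a complete intersection. -/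
open MvPolynomial

/-- An ideal containing every binomial that is homogeneous for the weights `n` contains
the toric ideal of `n`. -/
theorem toricIdeal_le_of_binomial_mem {K : Type*} [Field K] {n : Fin 4 → ℕ}
    {J : Ideal (MvPolynomial (Fin 4) K)}
    (h : ∀ u v : Fin 4 →₀ ℕ, ∑ i, n i * u i = ∑ i, n i * v i →
      (monomial u (1 : K)) - monomial v 1 ∈ J) :
    toricIdeal K n ≤ J := by
  classical
  let s : Polynomial K →ₗ[K] (MvPolynomial (Fin 4) K ⧸ J) :=
    (Polynomial.basisMonomials K).constr K fun k =>
      if hk : ∃ u : Fin 4 →₀ ℕ, ∑ i, n i * u i = k then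
        Ideal.Quotient.mk J (monomial hk.choose 1) else 0
  let φ : MvPolynomial (Fin 4) K →ₐ[K] Polynomial K :=
    aeval (fun i => (Polynomial.X : Polynomial K) ^ n i)
  have key : s ∘ₗ φ.toLinearMap = (Ideal.Quotient.mkₐ K J).toLinearMap := by
    refine (basisMonomials (Fin 4) K).ext fun u => ?_
    have hφ : φ (monomial u 1) = Polynomial.basisMonomials K (∑ i, n i * u i) := by
      simp [φ, aeval_monomial, Finsupp.prod_fintype, ← pow_mul, Finset.prod_pow_eq_pow_sum,
        Polynomial.monomial_one_right_eq_X_pow]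
    have hk : ∃ v : Fin 4 →₀ ℕ, ∑ i, n i * v i = ∑ i, n i * u i := ⟨u, rfl⟩
    simp only [coe_basisMonomials, LinearMap.comp_apply, AlgHom.toLinearMap_apply, hφ,
      Ideal.Quotient.mkₐ_eq_mk, s, Module.Basis.constr_basis, dif_pos hk]
    exact Ideal.Quotient.eq.2 (h _ _ hk.choose_spec)
  intro p hp
  have hp' : φ p = 0 := hp
  have := LinearMap.congr_fun key p
  exact Ideal.Quotient.eq_zero_iff_mem.1 (by simpa [hp'] using this.symm)

/-- In a commutative monoid with relations `x ^ b1 = y ^ b2`, `z ^ b3 = x ^ c1 * y ^ c2` and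
`w ^ b4 = x ^ m1 * y ^ m2 * z ^ m3`, every monomial equals one of the same weight whose exponents
in `y`, `z`, `w` are reduced. -/
theorem exists_reduced_monomial {M : Type*} [CommMonoid M] {x y z w : M}
    {b1 b2 b3 b4 c1 c2 m1 m2 m3 N0 N1 N2 N3 : ℕ}
    (hb2 : 0 < b2) (hb3 : 0 < b3) (hb4 : 0 < b4)
    (hy : y ^ b2 = x ^ b1) (hz : z ^ b3 = x ^ c1 * y ^ c2)
    (hw : w ^ b4 = x ^ m1 * y ^ m2 * z ^ m3)
    (h1 : N1 * b2 = N0 * b1) (h2 : N2 * b3 = N0 * c1 + N1 * c2)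
    (h3 : N3 * b4 = N0 * m1 + N1 * m2 + N2 * m3) (a f e d : ℕ) :
    ∃ a' f' e' d', f' < b2 ∧ e' < b3 ∧ d' < b4 ∧
      x ^ a * y ^ f * z ^ e * w ^ d = x ^ a' * y ^ f' * z ^ e' * w ^ d' ∧
      N0 * a + N1 * f + N2 * e + N3 * d = N0 * a' + N1 * f' + N2 * e' + N3 * d' := by
  have reduce_w : ∀ a f e d, ∃ a' f' e' d', d' < b4 ∧
      x ^ a * y ^ f * z ^ e * w ^ d = x ^ a' * y ^ f' * z ^ e' * w ^ d' ∧
      N0 * a + N1 * f + N2 * e + N3 * d = N0 * a' + N1 * f' + N2 * e' + N3 * d' := by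
    intro a f e d
    refine ⟨a + m1 * (d / b4), f + m2 * (d / b4), e + m3 * (d / b4), d % b4,
      Nat.mod_lt _ hb4, ?_, ?_⟩
    · conv_lhs => rw [← Nat.div_add_mod d b4, pow_add, pow_mul, hw]
      simp only [pow_add, pow_mul, mul_pow]
      ac_rfl
    · conv_lhs => rw [← Nat.div_add_mod d b4]
      linear_combination (d / b4) * h3
  have reduce_z : ∀ a f e, ∃ a' f' e', e' < b3 ∧
      x ^ a * y ^ f * z ^ e = x ^ a' * y ^ f' * z ^ e' ∧
      N0 * a + N1 * f + N2 * e = N0 * a' + N1 * f' + N2 * e' := by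
    intro a f e
    refine ⟨a + c1 * (e / b3), f + c2 * (e / b3), e % b3, Nat.mod_lt _ hb3, ?_, ?_⟩
    · conv_lhs => rw [← Nat.div_add_mod e b3, pow_add, pow_mul, hz]
      simp only [pow_add, pow_mul, mul_pow]
      ac_rfl
    · conv_lhs => rw [← Nat.div_add_mod e b3]
      linear_combination (e / b3) * h2
  have reduce_y : ∀ a f, ∃ a' f', f' < b2 ∧
      x ^ a * y ^ f = x ^ a' * y ^ f' ∧ N0 * a + N1 * f = N0 * a' + N1 * f' := by
    intro a f
    refine ⟨a + b1 * (f / b2), f % b2, Nat.mod_lt _ hb2, ?_, ?_⟩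
    · conv_lhs => rw [← Nat.div_add_mod f b2, pow_add, pow_mul, hy]
      simp only [pow_add, pow_mul]
      ac_rfl
    · conv_lhs => rw [← Nat.div_add_mod f b2]
      linear_combination (f / b2) * h1
  obtain ⟨a1, f1, e1, d1, hd, hm1, hn1⟩ := reduce_w a f e d
  obtain ⟨a2, f2, e2, he, hm2, hn2⟩ := reduce_z a1 f1 e1
  obtain ⟨a3, f3, hf, hm3, hn3⟩ := reduce_y a2 f2
  exact ⟨a3, f3, e2, d1, hf, he, hd, by rw [hm1, hm2, hm3], by omega⟩

theorem eq_zero_of_abs_lt_of_dvd_mul {b k v : ℤ} (h : IsCoprime b k) (hd : b ∣ v * k)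
    (hv : |v| < b) : v = 0 :=
  Int.eq_zero_of_abs_lt_dvd (h.dvd_of_dvd_mul_right hd) hv

/-- Integer relations among the weights with reduced exponents are trivial. -/
theorem eq_zero_of_reduced_relation {b1 b2 b3 b4 s t m3 : ℤ}
    (h12 : IsCoprime b2 b1) (h3 : IsCoprime b3 s) (h4 : IsCoprime b4 (m3 * s + b3 * t))
    {a f e d : ℤ} (hf : |f| < b2) (he : |e| < b3) (hd : |d| < b4)
    (h : b2 * b3 * b4 * a + b1 * b3 * b4 * f + b4 * s * e + (m3 * s + b3 * t) * d = 0) :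
    a = 0 ∧ f = 0 ∧ e = 0 ∧ d = 0 := by
  have hb2 : b2 ≠ 0 := ((abs_nonneg f).trans_lt hf).ne'
  have hb3 : b3 ≠ 0 := ((abs_nonneg e).trans_lt he).ne'
  have hb4 : b4 ≠ 0 := ((abs_nonneg d).trans_lt hd).ne'
  obtain rfl : d = 0 := eq_zero_of_abs_lt_of_dvd_mul h4
    ⟨-(b2 * b3 * a + b1 * b3 * f + s * e), by linear_combination h⟩ hd
  have h' : b2 * b3 * a + b1 * b3 * f + s * e = 0 :=
    mul_left_cancel₀ hb4 (by linear_combination h)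
  obtain rfl : e = 0 := eq_zero_of_abs_lt_of_dvd_mul h3
    ⟨-(b2 * a + b1 * f), by linear_combination h'⟩ he
  have h'' : b2 * a + b1 * f = 0 := mul_left_cancel₀ hb3 (by linear_combination h')
  obtain rfl : f = 0 := eq_zero_of_abs_lt_of_dvd_mul h12 ⟨-a, by linear_combination h''⟩ hf
  exact ⟨mul_left_cancel₀ hb2 (by linear_combination h''), rfl, rfl, rfl⟩

theorem stmt1 (K : Type*) [Field K] (b1 b2 b3 b4 c1 c2 m1 m2 m3 : ℕ)
    (hb1 : 1 ≤ b1) (hb2 : 1 ≤ b2) (hb3 : 1 ≤ b3) (hb4 : 1 ≤ b4)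
    (hc : ¬(c1 = 0 ∧ c2 = 0)) (hm : ¬(m1 = 0 ∧ m2 = 0 ∧ m3 = 0))
    (n : Fin 4 → ℕ)
    (hn : n = ![b2 * b3 * b4, b1 * b3 * b4,
      b4 * (b1 * c2 + c1 * b2), m3 * (b1 * c2 + b2 * c1) + b3 * (b1 * m2 + m1 * b2)])
    (hgcd : Nat.gcd (Nat.gcd (Nat.gcd (n 0) (n 1)) (n 2)) (n 3) = 1) :
    toricIdeal K n =
      Ideal.span {(X 0 : MvPolynomial (Fin 4) K) ^ b1 - X 1 ^ b2,
        X 2 ^ b3 - X 0 ^ c1 * X 1 ^ c2,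
        X 3 ^ b4 - X 0 ^ m1 * X 1 ^ m2 * X 2 ^ m3} ∧
    ∃ g1 g2 g3 : MvPolynomial (Fin 4) K,
      toricIdeal K n = Ideal.span {g1, g2, g3} := by
  suffices H : toricIdeal K n =
      Ideal.span {(X 0 : MvPolynomial (Fin 4) K) ^ b1 - X 1 ^ b2,
        X 2 ^ b3 - X 0 ^ c1 * X 1 ^ c2,
        X 3 ^ b4 - X 0 ^ m1 * X 1 ^ m2 * X 2 ^ m3} from ⟨H, _, _, _, H⟩
  have e0 : n 0 = b2 * b3 * b4 := by simp [hn]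
  have e1 : n 1 = b1 * b3 * b4 := by simp [hn]
  have e2 : n 2 = b4 * (b1 * c2 + b2 * c1) := by simp [hn, mul_comm c1]
  have e3 : n 3 = m3 * (b1 * c2 + b2 * c1) + b3 * (b1 * m2 + m1 * b2) := by simp [hn]
  have dvd_one : ∀ g, g ∣ n 0 → g ∣ n 1 → g ∣ n 2 → g ∣ n 3 → g ∣ 1 := fun g h0 h1 h2 h3 =>
    hgcd ▸ Nat.dvd_gcd (Nat.dvd_gcd (Nat.dvd_gcd h0 h1) h2) h3
  have h12 : Nat.Coprime b2 b1 := by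
    refine Nat.Coprime.symm (Nat.coprime_of_dvd' fun g _ hg1 hg2 => dvd_one g ?_ ?_ ?_ ?_)
    · rw [e0]; exact (hg2.mul_right _).mul_right _
    · rw [e1]; exact (hg1.mul_right _).mul_right _
    · rw [e2]; exact (dvd_add (hg1.mul_right _) (hg2.mul_right _)).mul_left _
    · rw [e3]; exact dvd_add ((dvd_add (hg1.mul_right _) (hg2.mul_right _)).mul_left _)
        ((dvd_add (hg1.mul_right _) (hg2.mul_left _)).mul_left _)
  have h3 : Nat.Coprime b3 (b1 * c2 + b2 * c1) := by
    refine Nat.coprime_of_dvd' fun g _ hg1 hg2 => dvd_one g ?_ ?_ ?_ ?_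
    · rw [e0]; exact (hg1.mul_left _).mul_right _
    · rw [e1]; exact (hg1.mul_left _).mul_right _
    · rw [e2]; exact hg2.mul_left _
    · rw [e3]; exact dvd_add (hg2.mul_left _) (hg1.mul_right _)
  have h4 : Nat.Coprime b4 (n 3) := by
    refine Nat.coprime_of_dvd' fun g _ hg1 hg2 => dvd_one g ?_ ?_ ?_ hg2
    · rw [e0]; exact hg1.mul_left _
    · rw [e1]; exact hg1.mul_left _
    · rw [e2]; exact hg1.mul_right _
  have w1 : n 1 * b2 = n 0 * b1 := by rw [e0, e1]; ring
  have w2 : n 2 * b3 = n 0 * c1 + n 1 * c2 := by rw [e0, e1, e2]; ring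
  have w3 : n 3 * b4 = n 0 * m1 + n 1 * m2 + n 2 * m3 := by rw [e0, e1, e2, e3]; ring
  refine le_antisymm (toricIdeal_le_of_binomial_mem fun u v huv => ?_) ?_
  · set J := Ideal.span {(X 0 : MvPolynomial (Fin 4) K) ^ b1 - X 1 ^ b2,
      X 2 ^ b3 - X 0 ^ c1 * X 1 ^ c2, X 3 ^ b4 - X 0 ^ m1 * X 1 ^ m2 * X 2 ^ m3} with hJ
    let q := Ideal.Quotient.mk J
    have ry : q (X 1) ^ b2 = q (X 0) ^ b1 := by
      simp only [← map_pow]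
      exact (Ideal.Quotient.eq.2 (Ideal.subset_span (by simp))).symm
    have rz : q (X 2) ^ b3 = q (X 0) ^ c1 * q (X 1) ^ c2 := by
      simp only [← map_pow, ← map_mul]
      exact Ideal.Quotient.eq.2 (Ideal.subset_span (by simp))
    have rw' : q (X 3) ^ b4 = q (X 0) ^ m1 * q (X 1) ^ m2 * q (X 2) ^ m3 := by
      simp only [← map_pow, ← map_mul]
      exact Ideal.Quotient.eq.2 (Ideal.subset_span (by simp))
    have hq : ∀ u : Fin 4 →₀ ℕ, q (monomial u 1) =
        q (X 0) ^ u 0 * q (X 1) ^ u 1 * q (X 2) ^ u 2 * q (X 3) ^ u 3 := by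
      intro u
      simp [monomial_eq, Finsupp.prod_fintype, Fin.prod_univ_four]
    obtain ⟨a, f, e, d, hf, he, hd, hu, hnu⟩ := exists_reduced_monomial hb2 hb3 hb4 ry rz rw'
      w1 w2 w3 (u 0) (u 1) (u 2) (u 3)
    obtain ⟨a', f', e', d', hf', he', hd', hv, hnv⟩ := exists_reduced_monomial hb2 hb3 hb4 ry rz
      rw' w1 w2 w3 (v 0) (v 1) (v 2) (v 3)
    have hdeg : n 0 * a + n 1 * f + n 2 * e + n 3 * d =
        n 0 * a' + n 1 * f' + n 2 * e' + n 3 * d' := by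
      simp only [Fin.sum_univ_four] at huv
      rw [← hnu, ← hnv, huv]
    rw [e3] at h4
    rw [e0, e1, e2, e3] at hdeg
    have h4' : IsCoprime (b4 : ℤ)
        (m3 * (b1 * c2 + b2 * c1 : ℤ) + b3 * (b1 * m2 + m1 * b2 : ℤ)) := by
      exact_mod_cast h4.isCoprime
    have h3' : IsCoprime (b3 : ℤ) (b1 * c2 + b2 * c1 : ℤ) := by exact_mod_cast h3.isCoprime
    obtain ⟨ha, hf0, he0, hd0⟩ := eq_zero_of_reduced_relation h12.isCoprime h3' h4'
      (a := a - a') (f := f - f') (e := e - e') (d := d - d')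
      (abs_lt.2 ⟨by omega, by omega⟩) (abs_lt.2 ⟨by omega, by omega⟩)
      (abs_lt.2 ⟨by omega, by omega⟩)
      (by zify at hdeg; linear_combination hdeg)
    obtain rfl : a = a' := by omega
    obtain rfl : f = f' := by omega
    obtain rfl : e = e' := by omega
    obtain rfl : d = d' := by omega
    refine Ideal.Quotient.eq.1 ?_
    change q _ = q _
    rw [hq, hq, hu, hv]
  · rw [Ideal.span_le]
    rintro p (rfl | rfl | rfl) <;>
      simp only [SetLike.mem_coe, toricIdeal, RingHom.mem_ker, map_sub, map_mul, map_pow, aeval_X,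
        ← pow_mul, ← pow_add, sub_eq_zero]
    · rw [w1]
    · rw [w2]
    · rw [w3]
end

section
/- Assume the Case (A) setup and let v = (a2·a3, a1·a3, a2·a4, a2·a3). Then for every integer w > 0 such that gcd(n1 + w·a2·a3, n2 + w·a1·a3, n3 + w·a2·a4, n4 + w·a2·a3) = 1, the toric ideal I(n + w·v) equals the ideal of K[x1,x2,x3,x4] generated by f1, f2 and x1^{u1+w}x2^{u2} − x3^{u3}x4^{u4+w}; in particular it is a complete intersection. -/
open MvPolynomial

theorem exists_shift_of_mul_add_mul_eq {p q a b a' b' : ℕ} (hq : 0 < q) (hpq : Nat.Coprime p q)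
    (h : p * a + q * b = p * a' + q * b') (hle : a ≤ a') :
    ∃ k, a' = a + k * q ∧ b = b' + k * p := by
  obtain ⟨c, rfl⟩ := Nat.exists_eq_add_of_le hle
  have h' : q * b = p * c + q * b' := by linarith
  have hdvd : q ∣ p * c :=
    (Nat.dvd_add_left (Dvd.intro _ rfl : q ∣ q * b')).1 (h' ▸ Dvd.intro _ rfl)
  obtain ⟨k, rfl⟩ := hpq.symm.dvd_of_dvd_mul_left hdvd
  refine ⟨k, by ring, Nat.eq_of_mul_eq_mul_left hq ?_⟩
  linarith

theorem pow_mul_pow_eq_of_weight_eq {R : Type*} [CommRing R] {x y : R} {a b : ℕ}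
    (ha : 0 < a) (hab : Nat.Coprime a b) (hxy : x ^ a = y ^ b) {i j i' j' : ℕ}
    (h : b * i + a * j = b * i' + a * j') : x ^ i * y ^ j = x ^ i' * y ^ j' := by
  wlog hle : i ≤ i' generalizing i j i' j'
  · exact (this h.symm (by omega)).symm
  obtain ⟨k, rfl, rfl⟩ := exists_shift_of_mul_add_mul_eq ha hab.symm h hle
  rw [pow_add, pow_add, mul_comm k, mul_comm k, pow_mul, pow_mul, hxy]
  ring

/-- Two monomials of the same weight under a gluing of two numerical semigroups agree as soon as
the three gluing relations hold. -/
theorem monomial_eq_of_weight_eq {R : Type*} [CommRing R] {x y z t : R}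
    {a1 a2 a3 a4 u1 u2 u3 u4 p q : ℕ} (ha1 : 0 < a1) (ha3 : 0 < a3)
    (h12 : Nat.Coprime a1 a2) (h34 : Nat.Coprime a3 a4)
    (hp : p = a3 * u4 + u3 * a4) (hq : q = a1 * u2 + u1 * a2) (hq0 : 0 < q)
    (hpq : Nat.Coprime p q) (hxy : x ^ a1 = y ^ a2) (hzt : z ^ a3 = t ^ a4)
    (hglue : x ^ u1 * y ^ u2 = z ^ u3 * t ^ u4) {i j k l i' j' k' l' : ℕ}
    (h : a2 * p * i + a1 * p * j + a4 * q * k + a3 * q * l =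
      a2 * p * i' + a1 * p * j' + a4 * q * k' + a3 * q * l') :
    x ^ i * y ^ j * z ^ k * t ^ l = x ^ i' * y ^ j' * z ^ k' * t ^ l' := by
  wlog hle : a2 * i + a1 * j ≤ a2 * i' + a1 * j' generalizing i j k l i' j' k' l'
  · exact (this h.symm (by omega)).symm
  obtain ⟨c, hc, hc'⟩ := exists_shift_of_mul_add_mul_eq (b := a4 * k + a3 * l)
    (b' := a4 * k' + a3 * l') hq0 hpq (by linarith) hle
  have e1 : x ^ (i + c * u1) * y ^ (j + c * u2) = x ^ i' * y ^ j' :=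
    pow_mul_pow_eq_of_weight_eq ha1 h12 hxy (by rw [hc, hq]; ring)
  have e2 : z ^ k * t ^ l = z ^ (k' + c * u3) * t ^ (l' + c * u4) :=
    pow_mul_pow_eq_of_weight_eq ha3 h34 hzt (by rw [hc', hp]; ring)
  calc x ^ i * y ^ j * z ^ k * t ^ l = x ^ i * y ^ j * (z ^ k * t ^ l) := by ring
    _ = x ^ i * y ^ j * (z ^ k' * t ^ l') * (z ^ u3 * t ^ u4) ^ c := by rw [e2]; ring
    _ = x ^ (i + c * u1) * y ^ (j + c * u2) * (z ^ k' * t ^ l') := by rw [← hglue]; ring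
    _ = x ^ i' * y ^ j' * z ^ k' * t ^ l' := by rw [e1]; ring

theorem aeval_X_pow_monomial (K : Type*) [Field K] (n : Fin 4 → ℕ) (m : Fin 4 →₀ ℕ) (c : K) :
    aeval (fun i => (Polynomial.X : Polynomial K) ^ n i) (monomial m c) =
      Polynomial.monomial (∑ i, n i * m i) c := by
  rw [aeval_monomial, Finsupp.prod_fintype _ _ (by simp)]
  simp only [← pow_mul, Finset.prod_pow_eq_pow_sum]
  rw [← Polynomial.C_mul_X_pow_eq_monomial]
  rfl

/-- A toric ideal is contained in every ideal modulo which monomials of equal weight agree. -/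
theorem toricIdeal_le_of_monomial_eq {K : Type*} [Field K] {n : Fin 4 → ℕ}
    {J : Ideal (MvPolynomial (Fin 4) K)}
    (h : ∀ m m' : Fin 4 →₀ ℕ, ∑ i, n i * m i = ∑ i, n i * m' i →
      Ideal.Quotient.mk J (monomial m 1) = Ideal.Quotient.mk J (monomial m' 1)) :
    toricIdeal K n ≤ J := by
  intro f hf
  let s : ℕ → (Fin 4 →₀ ℕ) := Function.invFun fun m => ∑ i, n i * m i
  have hs (m : Fin 4 →₀ ℕ) : ∑ i, n i * s (∑ i, n i * m i) i = ∑ i, n i * m i :=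
    Function.invFun_eq (f := fun m : Fin 4 →₀ ℕ => ∑ i, n i * m i) ⟨m, rfl⟩
  let φ : Polynomial K →ₗ[K] MvPolynomial (Fin 4) K ⧸ J :=
    (Polynomial.basisMonomials K).constr K fun d => Ideal.Quotient.mk J (monomial (s d) 1)
  have hφ : φ ∘ₗ (aeval fun i => (Polynomial.X : Polynomial K) ^ n i).toLinearMap =
      (Ideal.Quotient.mkₐ K J).toLinearMap := by
    refine (basisMonomials (Fin 4) K).ext fun m => ?_
    simp only [coe_basisMonomials, LinearMap.comp_apply, AlgHom.toLinearMap_apply,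
      aeval_X_pow_monomial, Ideal.Quotient.mkₐ_eq_mk]
    exact ((Polynomial.basisMonomials K).constr_basis K _ _).trans (h _ _ (hs m))
  have hf0 : aeval (fun i => (Polynomial.X : Polynomial K) ^ n i) f = 0 := hf
  have := LinearMap.congr_fun hφ f
  rw [LinearMap.comp_apply, AlgHom.toLinearMap_apply, hf0, map_zero] at this
  exact Ideal.Quotient.eq_zero_iff_mem.1 this.symm

/-- The toric ideal of a gluing of two pairs of weights is generated by the two binomials of the
pairs and the gluing binomial. -/
theorem toricIdeal_gluing_eq_span (K : Type*) [Field K] {a1 a2 a3 a4 u1 u2 u3 u4 p q : ℕ}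
    (ha1 : 0 < a1) (ha3 : 0 < a3) (h12 : Nat.Coprime a1 a2) (h34 : Nat.Coprime a3 a4)
    (hp : p = a3 * u4 + u3 * a4) (hq : q = a1 * u2 + u1 * a2) (hq0 : 0 < q)
    (hpq : Nat.Coprime p q) :
    toricIdeal K ![a2 * p, a1 * p, a4 * q, a3 * q] =
      Ideal.span {(X 0 : MvPolynomial (Fin 4) K) ^ a1 - X 1 ^ a2, X 2 ^ a3 - X 3 ^ a4,
        X 0 ^ u1 * X 1 ^ u2 - X 2 ^ u3 * X 3 ^ u4} := by
  apply le_antisymm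
  · apply toricIdeal_le_of_monomial_eq
    intro m m' h
    simp only [Fin.sum_univ_four, Matrix.cons_val] at h
    simp only [monomial_eq, Finsupp.prod_fintype _ _ (fun _ => pow_zero _), Fin.prod_univ_four,
      map_mul, map_pow, map_one, one_mul]
    refine monomial_eq_of_weight_eq ha1 ha3 h12 h34 hp hq hq0 hpq ?_ ?_ ?_ h <;>
      simp only [← map_pow, ← map_mul] <;>
      exact Ideal.Quotient.eq.2 (Ideal.subset_span (by simp))
  · rw [Ideal.span_le]
    rintro f (rfl | rfl | rfl) <;>
      simp only [toricIdeal, SetLike.mem_coe, RingHom.mem_ker, map_sub, map_mul, map_pow, aeval_X,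
        Matrix.cons_val, ← pow_mul, ← pow_add, sub_eq_zero] <;>
      congr 1 <;> subst hp hq <;> ring

theorem stmt3 (K : Type*) [Field K] (a1 a2 a3 a4 u1 u2 u3 u4 : ℕ)
    (ha1 : 0 < a1) (ha2 : 0 < a2) (ha3 : 0 < a3) (ha4 : 0 < a4)
    (hu12 : ¬(u1 = 0 ∧ u2 = 0)) (hu34 : ¬(u3 = 0 ∧ u4 = 0))
    (n : Fin 4 → ℕ)
    (hn : n = ![a2 * (a3 * u4 + u3 * a4), a1 * (a3 * u4 + u3 * a4),
      a4 * (a1 * u2 + u1 * a2), a3 * (a1 * u2 + u1 * a2)])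
    (v : Fin 4 → ℕ) (hv : v = ![a2 * a3, a1 * a3, a2 * a4, a2 * a3]) :
    ∀ w : ℕ, 0 < w →
      Nat.gcd (Nat.gcd (Nat.gcd (n 0 + w * v 0) (n 1 + w * v 1))
        (n 2 + w * v 2)) (n 3 + w * v 3) = 1 →
      toricIdeal K (fun j => n j + w * v j) =
        Ideal.span {(X 0 : MvPolynomial (Fin 4) K) ^ a1 - X 1 ^ a2,
          X 2 ^ a3 - X 3 ^ a4,
          X 0 ^ (u1 + w) * X 1 ^ u2 - X 2 ^ u3 * X 3 ^ (u4 + w)} ∧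
      ∃ g1 g2 g3 : MvPolynomial (Fin 4) K,
        toricIdeal K (fun j => n j + w * v j) = Ideal.span {g1, g2, g3} := by
  intro w hw hgcd
  set p := a3 * (u4 + w) + u3 * a4 with hp
  set q := a1 * u2 + (u1 + w) * a2 with hq
  have hweights : (fun j => n j + w * v j) = ![a2 * p, a1 * p, a4 * q, a3 * q] := by
    subst hn hv
    funext j
    fin_cases j <;> simp [hp, hq] <;> ring
  have hdvd (d : ℕ) (hd : ∀ j, d ∣ n j + w * v j) : d = 1 :=
    Nat.dvd_one.1 (hgcd ▸ Nat.dvd_gcd (Nat.dvd_gcd (Nat.dvd_gcd (hd 0) (hd 1)) (hd 2)) (hd 3))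
  have hdvd' (d : ℕ) (h0 : d ∣ a2 * p) (h1 : d ∣ a1 * p) (h2 : d ∣ a4 * q) (h3 : d ∣ a3 * q) :
      d = 1 := by
    refine hdvd d fun j => ?_
    rw [congrFun hweights j]
    fin_cases j <;> assumption
  have hq0 : 0 < q := by positivity
  have h12 : Nat.Coprime a1 a2 := by
    have h1 := Nat.gcd_dvd_left a1 a2
    have h2 := Nat.gcd_dvd_right a1 a2
    have h : Nat.gcd a1 a2 ∣ q := dvd_add (h1.mul_right _) (h2.mul_left _)
    exact hdvd' _ (h2.mul_right _) (h1.mul_right _) (h.mul_left _) (h.mul_left _)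
  have h34 : Nat.Coprime a3 a4 := by
    have h3 := Nat.gcd_dvd_left a3 a4
    have h4 := Nat.gcd_dvd_right a3 a4
    have h : Nat.gcd a3 a4 ∣ p := dvd_add (h3.mul_right _) (h4.mul_left _)
    exact hdvd' _ (h.mul_left _) (h.mul_left _) (h4.mul_right _) (h3.mul_right _)
  have hpq : Nat.Coprime p q := by
    have h1 := Nat.gcd_dvd_left p q
    have h2 := Nat.gcd_dvd_right p q
    exact hdvd' _ (h1.mul_left _) (h1.mul_left _) (h2.mul_left _) (h2.mul_left _)
  rw [hweights, toricIdeal_gluing_eq_span K ha1 ha3 h12 h34 hp hq hq0 hpq]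
  exact ⟨rfl, _, _, _, rfl⟩
end

section
/- Assume the Case (A) setup with gcd(n1,n2,n3,n4) = 1, u3 > 0, u4 > 0, n1 = min{n1,n2,n3,n4}, a3 < a4, u3 ≤ a3 and u2 = a2. Then the image of x1 is a nonzerodivisor in K[x1,x2,x3,x4]/I(n)_* if and only if a4 + u4 ≤ u1 + a1 + a3 − u3. -/
open MvPolynomial

/-- The ideal `I_*` generated by the least-degree nonzero homogeneous components `f_*`
of the nonzero elements `f ∈ I`. -/
noncomputable def idealStar {K : Type*} [Field K] (I : Ideal (MvPolynomial (Fin 4) K)) :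
    Ideal (MvPolynomial (Fin 4) K) :=
  Ideal.span {g | ∃ f ∈ I, f ≠ 0 ∧ ∃ d : ℕ,
    (∀ e < d, homogeneousComponent e f = 0) ∧
    homogeneousComponent d f ≠ 0 ∧ g = homogeneousComponent d f}

/-- The weight of the monomial with exponent vector `α`, where `xᵢ` has weight `n i`. -/
def expWeight (n : Fin 4 → ℕ) (α : Fin 4 →₀ ℕ) : ℕ := ∑ i, n i * α i

lemma expWeight_add (n : Fin 4 → ℕ) (α β : Fin 4 →₀ ℕ) :
    expWeight n (α + β) = expWeight n α + expWeight n β := by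
  simp [expWeight, mul_add, Finset.sum_add_distrib]

lemma degree_eq_sum_four (α : Fin 4 →₀ ℕ) : α.degree = α 0 + α 1 + α 2 + α 3 := by
  rw [Finsupp.degree_eq_sum, Fin.sum_univ_four]

section Parametrization

variable {K : Type*} [Field K]

/-- The parametrization `xᵢ ↦ t^{n i}` of the monomial curve. -/
noncomputable def curveMap (K : Type*) [Field K] (n : Fin 4 → ℕ) :
    MvPolynomial (Fin 4) K →ₐ[K] Polynomial K :=
  aeval (fun i => (Polynomial.X : Polynomial K) ^ n i)

lemma mem_toricIdeal {n : Fin 4 → ℕ} {f : MvPolynomial (Fin 4) K} :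
    f ∈ toricIdeal K n ↔ curveMap K n f = 0 := Iff.rfl

lemma curveMap_monomial (n : Fin 4 → ℕ) (α : Fin 4 →₀ ℕ) (c : K) :
    curveMap K n (monomial α c) = Polynomial.monomial (expWeight n α) c := by
  rw [curveMap, aeval_monomial, Finsupp.prod_fintype _ _ (by simp),
    ← Polynomial.C_mul_X_pow_eq_monomial, expWeight, ← Finset.prod_pow_eq_pow_sum]
  simp [pow_mul]

/-- Polynomials in `t` all of whose exponents are weights of monomials of degree at least `d`,
that is, the image of the `d`-th power of the maximal ideal at the origin. -/
def orderFiltration (K : Type*) [Field K] (n : Fin 4 → ℕ) (d : ℕ) :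
    Submodule K (Polynomial K) where
  carrier := {u | ∀ s, u.coeff s ≠ 0 → ∃ α, expWeight n α = s ∧ d ≤ α.degree}
  zero_mem' := by simp
  add_mem' := by
    intro u v hu hv s hs
    by_cases h : u.coeff s = 0
    · exact hv s (by simpa [h] using hs)
    · exact hu s h
  smul_mem' := by
    intro c u hu s hs
    exact hu s (by rintro h; simp [h] at hs)

lemma mem_orderFiltration {n : Fin 4 → ℕ} {d : ℕ} {u : Polynomial K} :
    u ∈ orderFiltration K n d ↔
      ∀ s, u.coeff s ≠ 0 → ∃ α, expWeight n α = s ∧ d ≤ α.degree := Iff.rfl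

lemma monomial_mem_orderFiltration {n : Fin 4 → ℕ} {d : ℕ} (α : Fin 4 →₀ ℕ) (c : K)
    (h : d ≤ α.degree) :
    Polynomial.monomial (expWeight n α) c ∈ orderFiltration K n d := by
  intro s hs
  rw [Polynomial.coeff_monomial] at hs
  exact ⟨α, by by_contra h; simp [h] at hs, h⟩

lemma curveMap_mem_orderFiltration {n : Fin 4 → ℕ} {d : ℕ} {f : MvPolynomial (Fin 4) K}
    (h : ∀ α ∈ f.support, d ≤ α.degree) : curveMap K n f ∈ orderFiltration K n d := by
  rw [f.as_sum, map_sum]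
  refine Submodule.sum_mem _ fun α hα => ?_
  rw [curveMap_monomial]
  exact monomial_mem_orderFiltration α _ (h α hα)

lemma monomial_mul_mem_orderFiltration {n : Fin 4 → ℕ} {d : ℕ} (β : Fin 4 →₀ ℕ) (c : K)
    {u : Polynomial K} (hu : u ∈ orderFiltration K n d) :
    Polynomial.monomial (expWeight n β) c * u ∈ orderFiltration K n (d + β.degree) := by
  intro s hs
  rw [← Polynomial.C_mul_X_pow_eq_monomial, mul_assoc, Polynomial.coeff_C_mul,
    Polynomial.coeff_X_pow_mul'] at hs
  split_ifs at hs with h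
  · obtain ⟨α, h1, h2⟩ := hu _ (right_ne_zero_of_mul hs)
    exact ⟨α + β, by rw [expWeight_add]; omega, by rw [map_add]; omega⟩
  · simp at hs

lemma exists_curveMap_eq {n : Fin 4 → ℕ} {d : ℕ} {u : Polynomial K}
    (hu : u ∈ orderFiltration K n d) :
    ∃ r : MvPolynomial (Fin 4) K, curveMap K n r = u ∧ ∀ e < d, homogeneousComponent e r = 0 := by
  choose! α hα using hu
  refine ⟨∑ s ∈ u.support, monomial (α s) (u.coeff s), ?_, ?_⟩
  · conv_rhs => rw [u.as_sum_support]
    rw [map_sum]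
    refine Finset.sum_congr rfl fun s hs => ?_
    rw [curveMap_monomial, (hα s (Polynomial.mem_support_iff.mp hs)).1]
  · intro e he
    rw [map_sum]
    refine Finset.sum_eq_zero fun s hs => ?_
    have h2 := (hα s (Polynomial.mem_support_iff.mp hs)).2
    ext β
    rw [coeff_homogeneousComponent, coeff_monomial, coeff_zero]
    split_ifs with h1 h3
    · subst h3; omega
    · rfl
    · rfl

lemma homogeneousComponent_monomial_mul (β : Fin 4 →₀ ℕ) (c : K)
    (g : MvPolynomial (Fin 4) K) (d : ℕ) :
    homogeneousComponent d (monomial β c * g) =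
      if β.degree ≤ d then monomial β c * homogeneousComponent (d - β.degree) g else 0 := by
  ext α
  have key : β ≤ α → α.degree = (α - β).degree + β.degree := fun h => by
    rw [← map_add, tsub_add_cancel_of_le h]
  rw [coeff_homogeneousComponent, coeff_monomial_mul']
  split_ifs with h1 h2 h3 h3
  · have := key h2
    rw [coeff_monomial_mul', if_pos h2, coeff_homogeneousComponent, if_pos (by omega)]
  · have := key h2
    omega
  · rw [coeff_monomial_mul', if_neg h2]
  · simp
  · rw [coeff_monomial_mul']
    split_ifs with h4
    · have := key h4
      rw [coeff_homogeneousComponent, if_neg (by omega), mul_zero]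
    · rfl
  · simp

lemma curveMap_mem_of_mem_idealStar {n : Fin 4 → ℕ} {g : MvPolynomial (Fin 4) K}
    (hg : g ∈ idealStar (toricIdeal K n)) (d : ℕ) :
    curveMap K n (homogeneousComponent d g) ∈ orderFiltration K n (d + 1) := by
  revert d
  refine Submodule.span_induction ?_ ?_ ?_ ?_ hg
  · rintro _ ⟨f, hf, -, e, hlow, -, rfl⟩ d
    rw [homogeneousComponent_of_mem (homogeneousComponent_mem _ _)]
    split_ifs with hde
    swap
    · simp
    subst hde
    have h : curveMap K n (homogeneousComponent d f) =
        - curveMap K n (f - homogeneousComponent d f) := by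
      rw [map_sub, mem_toricIdeal.mp hf]; simp
    rw [h]
    refine Submodule.neg_mem _ (curveMap_mem_orderFiltration fun α hα => ?_)
    rw [mem_support_iff, coeff_sub, coeff_homogeneousComponent] at hα
    by_contra hlt
    rcases Nat.lt_or_ge α.degree d with h1 | h1
    · have := congrArg (coeff α) (hlow _ h1)
      rw [coeff_homogeneousComponent] at this
      simp at this
      simp [this] at hα
    · simp [show α.degree = d by omega] at hα
  · simp
  · intro x y _ _ hx hy d
    simpa using Submodule.add_mem _ (hx d) (hy d)
  · intro p x _ hx d
    rw [smul_eq_mul, p.as_sum, Finset.sum_mul, map_sum, map_sum]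
    refine Submodule.sum_mem _ fun β _ => ?_
    rw [homogeneousComponent_monomial_mul]
    split_ifs with h
    · rw [map_mul, curveMap_monomial]
      have := monomial_mul_mem_orderFiltration β (coeff β p) (hx (d - β.degree))
      rwa [show d - β.degree + 1 + β.degree = d + 1 by omega] at this
    · simp

/-- The ideal `I_*` is the kernel of the passage to the associated graded ring of the order
filtration. -/
lemma mem_idealStar_iff {n : Fin 4 → ℕ} {g : MvPolynomial (Fin 4) K} :
    g ∈ idealStar (toricIdeal K n) ↔
      ∀ d, curveMap K n (homogeneousComponent d g) ∈ orderFiltration K n (d + 1) := by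
  refine ⟨curveMap_mem_of_mem_idealStar, fun h => ?_⟩
  rw [← sum_homogeneousComponent g]
  refine Ideal.sum_mem _ fun d _ => ?_
  by_cases h0 : homogeneousComponent d g = 0
  · simp [h0]
  obtain ⟨r, hr, hlow⟩ := exists_curveMap_eq (h d)
  have hself : homogeneousComponent d (homogeneousComponent d g) = homogeneousComponent d g := by
    rw [homogeneousComponent_of_mem (homogeneousComponent_mem _ _), if_pos rfl]
  have hcomp : homogeneousComponent d (homogeneousComponent d g - r) =
      homogeneousComponent d g := by
    rw [map_sub, hlow d (by omega), sub_zero, hself]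
  refine Ideal.subset_span ⟨homogeneousComponent d g - r, ?_, ?_, d, ?_, ?_, hcomp.symm⟩
  · rw [mem_toricIdeal, map_sub, hr, sub_self]
  · intro h1
    rw [h1, map_zero] at hcomp
    exact h0 hcomp.symm
  · intro e he
    rw [map_sub, hlow e (by omega), sub_zero,
      homogeneousComponent_of_mem (homogeneousComponent_mem _ _), if_neg (by omega)]
  · rwa [hcomp]

lemma monomial_mem_idealStar_iff {n : Fin 4 → ℕ} {α : Fin 4 →₀ ℕ} :
    monomial α (1 : K) ∈ idealStar (toricIdeal K n) ↔
      ∃ β, expWeight n β = expWeight n α ∧ α.degree < β.degree := by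
  have hhom : ∀ d, homogeneousComponent d (monomial α (1 : K)) =
      if d = α.degree then monomial α 1 else 0 := fun d => by
    rw [homogeneousComponent_of_mem (isHomogeneous_monomial 1 rfl)]
  rw [mem_idealStar_iff]
  constructor
  · intro h
    have h1 := h α.degree
    rw [hhom, if_pos rfl, curveMap_monomial] at h1
    exact h1 _ (by simp)
  · rintro ⟨β, h1, h2⟩ d
    rw [hhom]
    split_ifs with hd
    · rw [curveMap_monomial, ← h1]
      exact monomial_mem_orderFiltration _ _ (by omega)
    · simp

lemma mem_idealStar_of_X_mul_mem {n : Fin 4 → ℕ}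
    (hord : ∀ α γ : Fin 4 →₀ ℕ, expWeight n α = expWeight n γ + n 0 →
      ∃ β, expWeight n β = expWeight n γ ∧ α.degree ≤ β.degree + 1)
    {g : MvPolynomial (Fin 4) K} (hg : X 0 * g ∈ idealStar (toricIdeal K n)) :
    g ∈ idealStar (toricIdeal K n) := by
  rw [mem_idealStar_iff] at hg ⊢
  intro d s hs
  have hw : expWeight n (Finsupp.single 0 1) = n 0 := by
    simp [expWeight, Fin.sum_univ_four]
  have h1 := hg (d + 1)
  rw [show (X 0 : MvPolynomial (Fin 4) K) = monomial (Finsupp.single 0 1) 1 from rfl,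
    homogeneousComponent_monomial_mul, if_pos (by simp), map_mul, curveMap_monomial, hw,
    Finsupp.degree_single, Nat.add_sub_cancel] at h1
  obtain ⟨α, hα, hdeg⟩ := h1 (s + n 0) (by
    rw [Polynomial.monomial_one_right_eq_X_pow, Polynomial.coeff_X_pow_mul]
    exact hs)
  obtain ⟨γ, hγ, -⟩ := curveMap_mem_orderFiltration (d := 0) (fun _ _ => Nat.zero_le _) s hs
  obtain ⟨β, hβ, hβ'⟩ := hord α γ (by omega)
  exact ⟨β, by omega, by omega⟩

lemma mk_mem_nonZeroDivisors_iff {R : Type*} [CommRing R] (I : Ideal R) (x : R) :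
    Ideal.Quotient.mk I x ∈ nonZeroDivisors (R ⧸ I) ↔ ∀ y, x * y ∈ I → y ∈ I := by
  rw [mem_nonZeroDivisors_iff_left]
  constructor
  · intro h y hy
    rw [← Ideal.Quotient.eq_zero_iff_mem] at hy ⊢
    exact h _ (by rwa [← map_mul])
  · intro h y hy
    obtain ⟨y, rfl⟩ := Ideal.Quotient.mk_surjective y
    rw [← map_mul, Ideal.Quotient.eq_zero_iff_mem] at hy
    exact Ideal.Quotient.eq_zero_iff_mem.mpr (h y hy)

end Parametrization

/-- Two exponent vectors of equal weight, one of them without `x₁` and with `x₂`-exponent less than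
`a2`, differ by an explicit combination of the defining relations of the curve. -/
lemma exists_exponents_of_weight_eq {a1 a2 a3 a4 u3 u4 c D : ℕ} (ha2 : 0 < a2) (ha3 : 0 < a3)
    (hc : 0 < c) (hD : D = a3 * u4 + u3 * a4)
    (h12 : Nat.Coprime (a1 * D) a2) (hcD : Nat.Coprime c D) (h34 : Nat.Coprime a3 a4)
    {b p q i j k l : ℕ} (hb : b < a2)
    (h : a1 * D * b + a2 * a4 * c * p + a2 * a3 * c * q =
      a2 * D * i + a1 * D * j + a2 * a4 * c * k + a2 * a3 * c * l) :
    ∃ (t s : ℕ) (r : ℤ), j = b + a2 * t ∧ i + a1 * t = c * s ∧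
      (p : ℤ) = k + s * u3 + a3 * r ∧ (q : ℤ) = l + s * u4 - a4 * r := by
  zify at h hD
  have hj : (a2 : ℤ) ∣ j - b := by
    have h1 : IsCoprime (a2 : ℤ) (a1 * D) := by
      exact_mod_cast (Nat.isCoprime_iff_coprime.mpr h12.symm)
    refine h1.dvd_of_dvd_mul_left ⟨a4 * c * p + a3 * c * q - D * i - a4 * c * k - a3 * c * l, ?_⟩
    linear_combination -h
  obtain ⟨t', ht'⟩ := hj
  have ht0 : 0 ≤ t' := by
    by_contra hneg
    have : (a2 : ℤ) * t' ≤ a2 * (-1) := by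
      apply mul_le_mul_of_nonneg_left <;> omega
    omega
  lift t' to ℕ using ht0 with t
  have ha2' : (a2 : ℤ) ≠ 0 := by omega
  have h2 : (a4 * c * p + a3 * c * q : ℤ) = D * (i + a1 * t) + a4 * c * k + a3 * c * l := by
    apply mul_left_cancel₀ ha2'
    linear_combination h + a1 * D * ht'
  have hi : (c : ℤ) ∣ i + a1 * t := by
    have h1 : IsCoprime (c : ℤ) D := Nat.isCoprime_iff_coprime.mpr hcD
    refine h1.dvd_of_dvd_mul_left ⟨a4 * p + a3 * q - a4 * k - a3 * l, ?_⟩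
    linear_combination -h2
  obtain ⟨s, hs⟩ : c ∣ i + a1 * t := by exact_mod_cast hi
  zify at hs
  have hc' : (c : ℤ) ≠ 0 := by omega
  have h3 : (a4 * p + a3 * q : ℤ) = D * s + a4 * k + a3 * l := by
    apply mul_left_cancel₀ hc'
    linear_combination h2 + D * hs
  obtain ⟨r, hr⟩ : (a3 : ℤ) ∣ p - k - s * u3 := by
    have h1 : IsCoprime (a3 : ℤ) a4 := Nat.isCoprime_iff_coprime.mpr h34
    refine h1.dvd_of_dvd_mul_left ⟨l + s * u4 - q, ?_⟩
    linear_combination h3 + s * hD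
  refine ⟨t, s, r, by zify; linarith, by zify; exact hs, by linarith, ?_⟩
  have ha3' : (a3 : ℤ) ≠ 0 := by omega
  apply mul_left_cancel₀ ha3'
  linear_combination h3 + s * hD - a4 * hr

/-- A monomial having the same weight as some monomial divisible by `x₁` also has the same weight as
one of at least the same degree divisible by `x₁`. -/
lemma exists_degree_le_of_weight_eq {a1 a2 a3 a4 u3 u4 c D : ℕ} (ha2 : 0 < a2) (ha3 : 0 < a3)
    (ha1 : 0 < a1) (hc : 0 < c) (hD : D = a3 * u4 + u3 * a4)
    (h12 : Nat.Coprime (a1 * D) a2) (hcD : Nat.Coprime c D) (h34 : Nat.Coprime a3 a4)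
    (hu3a3 : u3 ≤ a3) (hle12 : a2 ≤ a1) (hle34 : a3 ≤ a4) (hlec : u3 + u4 ≤ c)
    (hle : a4 + u4 ≤ c + (a3 - u3))
    {i j k l b p q : ℕ}
    (h : a1 * D * b + a2 * a4 * c * p + a2 * a3 * c * q =
      a2 * D * (i + 1) + a1 * D * j + a2 * a4 * c * k + a2 * a3 * c * l) :
    ∃ i' j' k' l', a1 * D * b + a2 * a4 * c * p + a2 * a3 * c * q =
      a2 * D * (i' + 1) + a1 * D * j' + a2 * a4 * c * k' + a2 * a3 * c * l' ∧
      b + p + q ≤ i' + 1 + j' + k' + l' := by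
  induction p using Nat.strong_induction_on generalizing q with
  | _ p ih =>
  by_cases hb : a2 ≤ b
  · obtain ⟨b, rfl⟩ := Nat.exists_eq_add_of_le hb
    obtain ⟨a, rfl⟩ := Nat.exists_eq_add_of_le' ha1
    exact ⟨a, b, p, q, by ring, by omega⟩
  by_cases hpq : u3 ≤ p ∧ u4 ≤ q
  · obtain ⟨p, rfl⟩ := Nat.exists_eq_add_of_le hpq.1
    obtain ⟨q, rfl⟩ := Nat.exists_eq_add_of_le hpq.2
    obtain ⟨c, rfl⟩ := Nat.exists_eq_add_of_le' hc
    exact ⟨c, b, p, q, by rw [hD]; ring, by omega⟩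
  by_cases hq : a4 + u4 ≤ q
  · obtain ⟨q, rfl⟩ := Nat.exists_eq_add_of_le hq
    obtain ⟨e, rfl⟩ := Nat.exists_eq_add_of_le hu3a3
    obtain ⟨c, rfl⟩ := Nat.exists_eq_add_of_le' hc
    exact ⟨c, b, p + e, q, by rw [hD]; ring, by omega⟩
  by_cases hp : a3 ≤ p
  · obtain ⟨p, rfl⟩ := Nat.exists_eq_add_of_le hp
    have he : a1 * D * b + a2 * a4 * c * (a3 + p) + a2 * a3 * c * q =
        a1 * D * b + a2 * a4 * c * p + a2 * a3 * c * (a4 + q) := by ring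
    obtain ⟨i', j', k', l', h1, h2⟩ := ih p (by omega) (he ▸ h)
    exact ⟨i', j', k', l', he.trans h1, by omega⟩
  exfalso
  obtain ⟨t, s, r, -, h2, h3, h4⟩ :=
    exists_exponents_of_weight_eq ha2 ha3 hc hD h12 hcD h34 (by omega) h
  have hs : 1 ≤ s := by
    rcases Nat.eq_zero_or_pos s with rfl | hs
    · simp at h2
    · exact hs
  have hsu3 : (u3 : ℤ) ≤ s * u3 := by exact_mod_cast Nat.le_mul_of_pos_left u3 hs
  have hsu4 : (u4 : ℤ) ≤ s * u4 := by exact_mod_cast Nat.le_mul_of_pos_left u4 hs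
  rcases lt_trichotomy r 0 with hr | rfl | hr
  · have : (a4 : ℤ) * r ≤ a4 * (-1) := by
      apply mul_le_mul_of_nonneg_left <;> omega
    omega
  · apply hpq
    constructor <;> omega
  · have : (a3 : ℤ) * 1 ≤ a3 * r := by
      apply mul_le_mul_of_nonneg_left <;> omega
    omega

theorem stmt8 (K : Type*) [Field K] (a1 a2 a3 a4 u1 u2 u3 u4 : ℕ)
    (ha1 : 0 < a1) (ha2 : 0 < a2) (ha3 : 0 < a3) (ha4 : 0 < a4)
    (hu12 : ¬(u1 = 0 ∧ u2 = 0)) (hu34 : ¬(u3 = 0 ∧ u4 = 0))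
    (n : Fin 4 → ℕ)
    (hn : n = ![a2 * (a3 * u4 + u3 * a4), a1 * (a3 * u4 + u3 * a4),
      a4 * (a1 * u2 + u1 * a2), a3 * (a1 * u2 + u1 * a2)])
    (hgcd : Nat.gcd (Nat.gcd (Nat.gcd (n 0) (n 1)) (n 2)) (n 3) = 1)
    (hgen : toricIdeal K n = Ideal.span
      {(X 0 : MvPolynomial (Fin 4) K) ^ a1 - X 1 ^ a2,
       X 2 ^ a3 - X 3 ^ a4,
       X 0 ^ u1 * X 1 ^ u2 - X 2 ^ u3 * X 3 ^ u4})
    (hu3 : 0 < u3) (hu4 : 0 < u4)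
    (hmin : n 0 ≤ n 1 ∧ n 0 ≤ n 2 ∧ n 0 ≤ n 3)
    (ha34 : a3 < a4) (hu3a3 : u3 ≤ a3) (hu2a2 : u2 = a2) :
    (Ideal.Quotient.mk (idealStar (toricIdeal K n)) (X 0) ∈
      nonZeroDivisors (MvPolynomial (Fin 4) K ⧸ idealStar (toricIdeal K n))) ↔
    a4 + u4 ≤ u1 + a1 + (a3 - u3) := by
  obtain rfl : u2 = a2 := hu2a2
  set D := a3 * u4 + u3 * a4 with hD
  obtain ⟨c, hc⟩ : ∃ c, c = u1 + a1 := ⟨_, rfl⟩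
  have hc0 : 0 < c := by omega
  have hn0 : n 0 = u2 * D := by simp [hn]
  have hn1 : n 1 = a1 * D := by simp [hn]
  have hn2 : n 2 = u2 * a4 * c := by simp [hn, hc]; ring
  have hn3 : n 3 = u2 * a3 * c := by simp [hn, hc]; ring
  have hone : ∀ g : ℕ, g ∣ n 0 → g ∣ n 1 → g ∣ n 2 → g ∣ n 3 → g ∣ 1 := fun g h0 h1 h2 h3 =>
    hgcd ▸ Nat.dvd_gcd (Nat.dvd_gcd (Nat.dvd_gcd h0 h1) h2) h3
  rw [hn0, hn1, hn2, hn3] at hone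
  have h12 : Nat.Coprime (a1 * D) u2 := by
    have hl := Nat.gcd_dvd_left (a1 * D) u2
    have hr := Nat.gcd_dvd_right (a1 * D) u2
    exact Nat.dvd_one.mp (hone _ (hr.mul_right _) hl ((hr.mul_right _).mul_right _)
      ((hr.mul_right _).mul_right _))
  have hcD : Nat.Coprime c D := by
    have hl := Nat.gcd_dvd_left c D
    have hr := Nat.gcd_dvd_right c D
    exact Nat.dvd_one.mp (hone _ (hr.mul_left _) (hr.mul_left _) (hl.mul_left _) (hl.mul_left _))
  have h34 : Nat.Coprime a3 a4 := by
    have hl := Nat.gcd_dvd_left a3 a4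
    have hr := Nat.gcd_dvd_right a3 a4
    have hgD : Nat.gcd a3 a4 ∣ D := dvd_add (hl.mul_right _) (hr.mul_left _)
    exact Nat.dvd_one.mp (hone _ (hgD.mul_left _) (hgD.mul_left _)
      ((hr.mul_left _).mul_right _) ((hl.mul_left _).mul_right _))
  have hD0 : 0 < D := by positivity
  have hle12 : u2 ≤ a1 := by
    have := hmin.1
    rw [hn0, hn1] at this
    exact Nat.le_of_mul_le_mul_right this hD0
  have hlec : u3 + u4 ≤ c := by
    have h1 := hmin.2.2
    rw [hn0, hn3, mul_assoc] at h1
    have h2 := Nat.le_of_mul_le_mul_left h1 ha2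
    have h3 : u3 * a3 ≤ u3 * a4 := Nat.mul_le_mul_left _ ha34.le
    refine Nat.le_of_mul_le_mul_left ?_ ha3
    calc a3 * (u3 + u4) = a3 * u4 + u3 * a3 := by ring
      _ ≤ a3 * c := by omega
  have hwt : ∀ α : Fin 4 →₀ ℕ, expWeight n α =
      u2 * D * α 0 + a1 * D * α 1 + u2 * a4 * c * α 2 + u2 * a3 * c * α 3 := fun α => by
    rw [expWeight, Fin.sum_univ_four, hn0, hn1, hn2, hn3]
  rw [← hc, mk_mem_nonZeroDivisors_iff]
  constructor
  · intro hnzd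
    by_contra! hlt
    have hpow : ∀ m : ℕ, ∀ y, X 0 ^ m * y ∈ idealStar (toricIdeal K n) →
        y ∈ idealStar (toricIdeal K n) := by
      intro m
      induction m with
      | zero => simp
      | succ m ih =>
        intro y hy
        exact ih y (hnzd _ (by rwa [← mul_assoc, ← pow_succ']))
    have hmem : monomial (Finsupp.single 0 c + Finsupp.single 2 (a3 - u3)) (1 : K) ∈
        idealStar (toricIdeal K n) := by
      rw [monomial_mem_idealStar_iff]
      refine ⟨Finsupp.single 3 (a4 + u4), ?_, ?_⟩
      · obtain ⟨e, rfl⟩ := Nat.exists_eq_add_of_le hu3a3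
        rw [hwt, hwt]
        simp [hD]
        ring
      · simp only [map_add, Finsupp.degree_single]
        exact hlt
    have hz : monomial (Finsupp.single 2 (a3 - u3)) (1 : K) ∈ idealStar (toricIdeal K n) := by
      refine hpow c _ ?_
      rwa [X_pow_eq_monomial, monomial_mul, one_mul]
    rw [monomial_mem_idealStar_iff] at hz
    obtain ⟨β, h1, h2⟩ := hz
    rw [hwt, hwt] at h1
    rw [degree_eq_sum_four β, Finsupp.degree_single] at h2
    obtain ⟨t, s, r, e1, e2, e3, e4⟩ := exists_exponents_of_weight_eq (b := 0) (p := a3 - u3)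
      (q := 0) ha2 ha3 hc0 hD h12 hcD h34 ha2 (by simpa using h1.symm)
    have hsu4 : (s : ℤ) ≤ s * u4 := by exact_mod_cast Nat.le_mul_of_pos_right s hu4
    have hsu3 : (0 : ℤ) ≤ s * u3 := by positivity
    rcases lt_trichotomy r 0 with hr | rfl | hr
    · have : (a4 : ℤ) * r ≤ a4 * (-1) := by
        apply mul_le_mul_of_nonneg_left <;> omega
      omega
    · obtain rfl : s = 0 := by omega
      have : t ≤ a1 * t := Nat.le_mul_of_pos_left t ha1
      obtain rfl : t = 0 := by omega
      simp at e1 e2 e3 e4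
      omega
    · have : (a3 : ℤ) * 1 ≤ a3 * r := by
        apply mul_le_mul_of_nonneg_left <;> omega
      omega
  · intro hle y hy
    refine mem_idealStar_of_X_mul_mem (fun α γ h => ?_) hy
    rw [degree_eq_sum_four]
    by_cases h0 : α 0 = 0
    · rw [hwt, hwt, hn0, h0] at h
      obtain ⟨i, j, k, l, e1, e2⟩ := exists_degree_le_of_weight_eq ha2 ha3 ha1 hc0 hD h12 hcD h34
        hu3a3 hle12 ha34.le hlec hle (i := γ 0) (j := γ 1) (k := γ 2) (l := γ 3) (b := α 1)
        (p := α 2) (q := α 3) (by linarith)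
      refine ⟨Finsupp.equivFunOnFinite.symm ![i, j, k, l], ?_, ?_⟩
      · rw [hwt, hwt]
        simp
        linarith
      · rw [degree_eq_sum_four]
        simp
        omega
    · have hadd : α - Finsupp.single 0 1 + Finsupp.single 0 1 = α :=
        tsub_add_cancel_of_le (Finsupp.single_le_iff.mpr (Nat.one_le_iff_ne_zero.mpr h0))
      refine ⟨α - Finsupp.single 0 1, ?_, ?_⟩
      · have h1 := expWeight_add n (α - Finsupp.single 0 1) (Finsupp.single 0 1)
        have hw : expWeight n (Finsupp.single 0 1) = n 0 := by
          simp [expWeight, Fin.sum_univ_four]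
        rw [hadd] at h1
        omega
      · have h1 := congrArg Finsupp.degree hadd
        rw [map_add, Finsupp.degree_single, degree_eq_sum_four α] at h1
        omega
end

section
/- Assume the Case (B) setup and let b = (a2·a3, a1·a3, a1·u2 + u1·a2, a2·a3). Then for every integer w > 0 such that the four entries of n + w·b have greatest common divisor 1, the toric ideal I(n + w·b) equals the ideal of K[x1,x2,x3,x4] generated by f1, f2 and x4^{a4+w} − x1^{v1+w}x2^{v2}x3^{v3}; in particular it is a complete intersection. -/
open MvPolynomial

/-- Modulo the three binomial relations, every monomial in `y₀, y₁, y₂, y₃` equals one of the same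
weighted degree whose exponents at `y₀, y₂, y₃` are reduced. -/
theorem exists_normal_form {R : Type*} [CommRing R] {y₀ y₁ y₂ y₃ : R}
    {a1 a2 a3 A u1 u2 v1 v2 v3 : ℕ} (ha1 : 0 < a1) (ha3 : 0 < a3) (hA : 0 < A)
    (h1 : y₀ ^ a1 = y₁ ^ a2) (h2 : y₂ ^ a3 = y₀ ^ u1 * y₁ ^ u2)
    (h3 : y₃ ^ A = y₀ ^ v1 * y₁ ^ v2 * y₂ ^ v3) (k l j i : ℕ) :
    ∃ k' l' j' i', k' < a1 ∧ j' < a3 ∧ i' < A ∧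
      y₀ ^ k * y₁ ^ l * y₂ ^ j * y₃ ^ i = y₀ ^ k' * y₁ ^ l' * y₂ ^ j' * y₃ ^ i' ∧
      k * (a2 * a3 * A) + l * (a1 * a3 * A) + j * ((a1 * u2 + u1 * a2) * A) +
        i * (v3 * (a1 * u2 + u1 * a2) + a3 * (a1 * v2 + v1 * a2)) =
      k' * (a2 * a3 * A) + l' * (a1 * a3 * A) + j' * ((a1 * u2 + u1 * a2) * A) +
        i' * (v3 * (a1 * u2 + u1 * a2) + a3 * (a1 * v2 + v1 * a2)) := by
  obtain ⟨q, i', hi', rfl⟩ : ∃ q i', i' < A ∧ i = A * q + i' :=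
    ⟨i / A, i % A, Nat.mod_lt _ hA, (Nat.div_add_mod i A).symm⟩
  obtain ⟨r, j', hj', hj⟩ : ∃ r j', j' < a3 ∧ j + v3 * q = a3 * r + j' :=
    ⟨_, _, Nat.mod_lt _ ha3, (Nat.div_add_mod _ a3).symm⟩
  obtain ⟨s, k', hk', hk⟩ : ∃ s k', k' < a1 ∧ k + v1 * q + u1 * r = a1 * s + k' :=
    ⟨_, _, Nat.mod_lt _ ha1, (Nat.div_add_mod _ a1).symm⟩
  refine ⟨k', l + v2 * q + u2 * r + a2 * s, j', i', hk', hj', hi', ?_, ?_⟩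
  · calc y₀ ^ k * y₁ ^ l * y₂ ^ j * y₃ ^ (A * q + i')
        = y₀ ^ (k + v1 * q) * y₁ ^ (l + v2 * q) * y₂ ^ (j + v3 * q) * y₃ ^ i' := by
          rw [pow_add y₃, pow_mul, h3]; ring
      _ = y₀ ^ (k + v1 * q + u1 * r) * y₁ ^ (l + v2 * q + u2 * r) * y₂ ^ j' * y₃ ^ i' := by
          rw [hj, pow_add y₂, pow_mul y₂, h2]; ring
      _ = _ := by
          rw [hk, pow_add y₀, pow_mul y₀, h1]; ring
  · zify at hj hk ⊢
    linear_combination (a1 * u2 + u1 * a2 : ℤ) * A * hj + (a2 * a3 * A : ℤ) * hk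

/-- A congruence `x * c ≡ x' * c` modulo `N`, with `c` coprime to `N`, between reduced residues. -/
theorem eq_of_mul_add_mul_eq {N c x x' p p' : ℕ} (hc : Nat.Coprime N c) (hx : x < N)
    (hx' : x' < N) (h : N * p + x * c = N * p' + x' * c) : x = x' := by
  have hmod : x * c ≡ x' * c [MOD N] := by
    have := congrArg (· % N) h
    simpa [Nat.ModEq, Nat.mul_add_mod] using this
  exact Nat.ModEq.eq_of_lt_of_lt (Nat.ModEq.cancel_right_of_coprime hc hmod) hx hx'

/-- Reduced exponent vectors are determined by their weighted degree. -/
theorem normal_form_unique {a1 a2 a3 A D E k l j i k' l' j' i' : ℕ}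
    (hk : k < a1) (hj : j < a3) (hi : i < A) (hk' : k' < a1) (hj' : j' < a3) (hi' : i' < A)
    (h12 : Nat.Coprime a1 a2) (h3 : Nat.Coprime a3 D) (h4 : Nat.Coprime A E)
    (h : k * (a2 * a3 * A) + l * (a1 * a3 * A) + j * (D * A) + i * E =
      k' * (a2 * a3 * A) + l' * (a1 * a3 * A) + j' * (D * A) + i' * E) :
    k = k' ∧ l = l' ∧ j = j' ∧ i = i' := by
  obtain rfl : i = i' := eq_of_mul_add_mul_eq (p := k * (a2 * a3) + l * (a1 * a3) + j * D)
    (p' := k' * (a2 * a3) + l' * (a1 * a3) + j' * D) h4 hi hi' (by linarith)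
  have hD : a3 * (k * a2 + l * a1) + j * D = a3 * (k' * a2 + l' * a1) + j' * D :=
    Nat.eq_of_mul_eq_mul_right (Nat.zero_lt_of_lt hi) (by linarith)
  obtain rfl : j = j' := eq_of_mul_add_mul_eq h3 hj hj' hD
  have ha : k * a2 + l * a1 = k' * a2 + l' * a1 :=
    Nat.eq_of_mul_eq_mul_left (Nat.zero_lt_of_lt hj) (by linarith)
  obtain rfl : k = k' := eq_of_mul_add_mul_eq (p := l) (p' := l') h12 hk hk' (by linarith)
  exact ⟨rfl, Nat.eq_of_mul_eq_mul_right (Nat.zero_lt_of_lt hk) (by linarith), rfl, rfl⟩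

/-- If any two monomials of the same degree are congruent modulo `J`, then `J` contains the
toric ideal. -/
theorem toricIdeal_le_of_monomial {K : Type*} [Field K] {m : Fin 4 → ℕ}
    {J : Ideal (MvPolynomial (Fin 4) K)}
    (hJ : ∀ e e' : Fin 4 →₀ ℕ, ∑ i, e i * m i = ∑ i, e' i * m i →
      Ideal.Quotient.mk J (monomial e 1) = Ideal.Quotient.mk J (monomial e' 1)) :
    toricIdeal K m ≤ J := by
  classical
  let φ : MvPolynomial (Fin 4) K →ₐ[K] Polynomial K :=
    aeval (fun i => (Polynomial.X : Polynomial K) ^ m i)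
  let s : Polynomial K →ₗ[K] MvPolynomial (Fin 4) K ⧸ J :=
    (Polynomial.basisMonomials K).constr K fun d =>
      if h : ∃ e : Fin 4 →₀ ℕ, ∑ i, e i * m i = d then
        Ideal.Quotient.mk J (monomial h.choose 1) else 0
  have hs : s ∘ₗ φ.toLinearMap = (Ideal.Quotient.mkₐ K J).toLinearMap := by
    refine (MvPolynomial.basisMonomials (Fin 4) K).ext fun e => ?_
    have hφ : φ (monomial e 1) = Polynomial.basisMonomials K (∑ i, e i * m i) := by
      simp only [φ, aeval_monomial, map_one, one_mul, Polynomial.coe_basisMonomials,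
        Polynomial.monomial_one_right_eq_X_pow]
      rw [Finsupp.prod_fintype _ _ (by simp), ← Finset.prod_pow_eq_pow_sum]
      exact Finset.prod_congr rfl fun i _ => by rw [← pow_mul, mul_comm]
    have h : ∃ e' : Fin 4 →₀ ℕ, ∑ i, e' i * m i = ∑ i, e i * m i := ⟨e, rfl⟩
    simp only [coe_basisMonomials, LinearMap.comp_apply, AlgHom.toLinearMap_apply]
    rw [hφ, Module.Basis.constr_basis, dif_pos h]
    exact hJ _ _ h.choose_spec
  intro p hp
  have hp0 : φ p = 0 := hp
  have := LinearMap.congr_fun hs p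
  simp only [LinearMap.comp_apply, AlgHom.toLinearMap_apply, hp0, map_zero] at this
  exact Ideal.Quotient.eq_zero_iff_mem.mp this.symm

theorem toricIdeal_eq_span_of_gcd_eq_one (K : Type*) [Field K] {a1 a2 a3 A u1 u2 v1 v2 v3 : ℕ}
    (ha1 : 0 < a1) (ha3 : 0 < a3) (hA : 0 < A) {m : Fin 4 → ℕ}
    (hm0 : m 0 = a2 * a3 * A) (hm1 : m 1 = a1 * a3 * A) (hm2 : m 2 = (a1 * u2 + u1 * a2) * A)
    (hm3 : m 3 = v3 * (a1 * u2 + u1 * a2) + a3 * (a1 * v2 + v1 * a2))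
    (hgcd : Nat.gcd (Nat.gcd (Nat.gcd (m 0) (m 1)) (m 2)) (m 3) = 1) :
    toricIdeal K m =
      Ideal.span {(X 0 : MvPolynomial (Fin 4) K) ^ a1 - X 1 ^ a2,
          X 2 ^ a3 - X 0 ^ u1 * X 1 ^ u2,
          X 3 ^ A - X 0 ^ v1 * X 1 ^ v2 * X 2 ^ v3} := by
  have hdvd {d : ℕ} (h0 : d ∣ m 0) (h1 : d ∣ m 1) (h2 : d ∣ m 2) (h3 : d ∣ m 3) : d = 1 :=
    Nat.dvd_one.mp (hgcd ▸ Nat.dvd_gcd (Nat.dvd_gcd (Nat.dvd_gcd h0 h1) h2) h3)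
  rw [hm0, hm1, hm2, hm3] at hdvd
  have h4 : Nat.Coprime A (v3 * (a1 * u2 + u1 * a2) + a3 * (a1 * v2 + v1 * a2)) :=
    hdvd ((Nat.gcd_dvd_left _ _).mul_left _) ((Nat.gcd_dvd_left _ _).mul_left _)
      ((Nat.gcd_dvd_left _ _).mul_left _) (Nat.gcd_dvd_right _ _)
  have h3 : Nat.Coprime a3 (a1 * u2 + u1 * a2) := by
    have hl := Nat.gcd_dvd_left a3 (a1 * u2 + u1 * a2)
    have hr := Nat.gcd_dvd_right a3 (a1 * u2 + u1 * a2)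
    exact hdvd ((hl.mul_left _).mul_right _) ((hl.mul_left _).mul_right _) (hr.mul_right _)
      (dvd_add (hr.mul_left _) (hl.mul_right _))
  have h12 : Nat.Coprime a1 a2 := by
    have hl := Nat.gcd_dvd_left a1 a2
    have hr := Nat.gcd_dvd_right a1 a2
    have hD := dvd_add (hl.mul_right u2) (hr.mul_left u1)
    exact hdvd ((hr.mul_right _).mul_right _) ((hl.mul_right _).mul_right _) (hD.mul_right _)
      (dvd_add (hD.mul_left _) ((dvd_add (hl.mul_right _) (hr.mul_left _)).mul_left _))
  apply le_antisymm
  · apply toricIdeal_le_of_monomial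
    intro e e' hee
    set J := Ideal.span {(X 0 : MvPolynomial (Fin 4) K) ^ a1 - X 1 ^ a2,
          X 2 ^ a3 - X 0 ^ u1 * X 1 ^ u2,
          X 3 ^ A - X 0 ^ v1 * X 1 ^ v2 * X 2 ^ v3} with hJ
    have hmk (f : Fin 4 →₀ ℕ) : Ideal.Quotient.mk J (monomial f 1) =
        Ideal.Quotient.mk J (X 0) ^ f 0 * Ideal.Quotient.mk J (X 1) ^ f 1 *
          Ideal.Quotient.mk J (X 2) ^ f 2 * Ideal.Quotient.mk J (X 3) ^ f 3 := by
      rw [monomial_eq, Finsupp.prod_fintype _ _ (by simp)]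
      simp [Fin.prod_univ_four]
    have r1 : Ideal.Quotient.mk J (X 0) ^ a1 = Ideal.Quotient.mk J (X 1) ^ a2 := by
      simp only [← map_pow]
      exact Ideal.Quotient.eq.mpr (Ideal.subset_span (by simp))
    have r2 : Ideal.Quotient.mk J (X 2) ^ a3 =
        Ideal.Quotient.mk J (X 0) ^ u1 * Ideal.Quotient.mk J (X 1) ^ u2 := by
      simp only [← map_pow, ← map_mul]
      exact Ideal.Quotient.eq.mpr (Ideal.subset_span (by simp))
    have r3 : Ideal.Quotient.mk J (X 3) ^ A = Ideal.Quotient.mk J (X 0) ^ v1 *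
        Ideal.Quotient.mk J (X 1) ^ v2 * Ideal.Quotient.mk J (X 2) ^ v3 := by
      simp only [← map_pow, ← map_mul]
      exact Ideal.Quotient.eq.mpr (Ideal.subset_span (by simp))
    obtain ⟨k, l, j, i, hk, hj, hi, hy, hd⟩ :=
      exists_normal_form ha1 ha3 hA r1 r2 r3 (e 0) (e 1) (e 2) (e 3)
    obtain ⟨k', l', j', i', hk', hj', hi', hy', hd'⟩ :=
      exists_normal_form ha1 ha3 hA r1 r2 r3 (e' 0) (e' 1) (e' 2) (e' 3)
    rw [Fin.sum_univ_four, Fin.sum_univ_four, hm0, hm1, hm2, hm3] at hee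
    obtain ⟨rfl, rfl, rfl, rfl⟩ := normal_form_unique hk hj hi hk' hj' hi' h12 h3 h4
      (hd.symm.trans (hee.trans hd'))
    rw [hmk, hmk, hy, hy']
  · rw [Ideal.span_le]
    rintro p (rfl | rfl | rfl) <;>
    · simp only [toricIdeal, SetLike.mem_coe, RingHom.mem_ker, map_sub, map_mul, map_pow, aeval_X,
        hm0, hm1, hm2, hm3, ← pow_mul, ← pow_add, sub_eq_zero]
      congr 1
      ring

theorem stmt13 (K : Type*) [Field K] (a1 a2 a3 a4 u1 u2 v1 v2 v3 : ℕ)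
    (ha1 : 0 < a1) (ha2 : 0 < a2) (ha3 : 0 < a3) (ha4 : 0 < a4)
    (hu12 : ¬(u1 = 0 ∧ u2 = 0)) (hv123 : ¬(v1 = 0 ∧ v2 = 0 ∧ v3 = 0))
    (n : Fin 4 → ℕ)
    (hn : n = ![a2 * a3 * a4, a1 * a3 * a4, a4 * (a1 * u2 + u1 * a2),
      v3 * (a1 * u2 + a2 * u1) + a3 * (a1 * v2 + v1 * a2)])
    (b : Fin 4 → ℕ)
    (hb : b = ![a2 * a3, a1 * a3, a1 * u2 + u1 * a2, a2 * a3]) :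
    ∀ w : ℕ, 0 < w →
      Nat.gcd (Nat.gcd (Nat.gcd (n 0 + w * b 0) (n 1 + w * b 1))
        (n 2 + w * b 2)) (n 3 + w * b 3) = 1 →
      toricIdeal K (fun j => n j + w * b j) =
        Ideal.span {(X 0 : MvPolynomial (Fin 4) K) ^ a1 - X 1 ^ a2,
          X 2 ^ a3 - X 0 ^ u1 * X 1 ^ u2,
          X 3 ^ (a4 + w) - X 0 ^ (v1 + w) * X 1 ^ v2 * X 2 ^ v3} ∧
      ∃ g1 g2 g3 : MvPolynomial (Fin 4) K,
        toricIdeal K (fun j => n j + w * b j) = Ideal.span {g1, g2, g3} := by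
  intro w hw hgcd
  have key := toricIdeal_eq_span_of_gcd_eq_one K (a1 := a1) (a2 := a2) (a3 := a3) (A := a4 + w)
    (u1 := u1) (u2 := u2) (v1 := v1 + w) (v2 := v2) (v3 := v3) ha1 ha3 (by omega)
    (m := fun j => n j + w * b j) (by simp [hn, hb]; ring) (by simp [hn, hb]; ring)
    (by simp [hn, hb]; ring) (by simp [hn, hb]; ring) hgcd
  exact ⟨key, _, _, _, key⟩
end

section
/- Assume the Case (B) setup and let b = (0, 0, a4(a1 + a2), v3(a1 + a2) + a3(a1 + a2)). Then for every integer w > 0 such that the four entries of n + w·b have greatest common divisor 1, the toric ideal I(n + w·b) equals the ideal of K[x1,x2,x3,x4] generated by f1, x3^{a3} − x1^{u1+w}x2^{u2+w} and x4^{a4} − x1^{v1+w}x2^{v2+w}x3^{v3}; in particular it is a complete intersection. -/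
open MvPolynomial

/-- Modulo the relations `x ^ a₁ = y ^ a₂`, `z ^ a₃ = x ^ p * y ^ q` and
`t ^ a₄ = x ^ r * y ^ s * z ^ c`, every monomial equals one whose last three exponents are reduced, of the same weighted degree. -/
theorem exists_reduced_monomial_s14 {A : Type*} [CommRing A] {x y z t : A}
    {a1 a2 a3 a4 p q r s c : ℕ} (ha2 : 0 < a2) (ha3 : 0 < a3) (ha4 : 0 < a4)
    (h1 : x ^ a1 = y ^ a2) (h2 : z ^ a3 = x ^ p * y ^ q)
    (h3 : t ^ a4 = x ^ r * y ^ s * z ^ c) (i j k l : ℕ) :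
    ∃ i' j' k' l', j' < a2 ∧ k' < a3 ∧ l' < a4 ∧
      x ^ i * y ^ j * z ^ k * t ^ l = x ^ i' * y ^ j' * z ^ k' * t ^ l' ∧
      a2 * a3 * a4 * i + a1 * a3 * a4 * j + a4 * (a1 * q + p * a2) * k
          + (c * (a1 * q + a2 * p) + a3 * (a1 * s + r * a2)) * l =
        a2 * a3 * a4 * i' + a1 * a3 * a4 * j' + a4 * (a1 * q + p * a2) * k'
          + (c * (a1 * q + a2 * p) + a3 * (a1 * s + r * a2)) * l' := by
  obtain ⟨d, l', hl', rfl⟩ : ∃ d l', l' < a4 ∧ l = a4 * d + l' :=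
    ⟨l / a4, l % a4, Nat.mod_lt _ ha4, (Nat.div_add_mod _ _).symm⟩
  obtain ⟨e, k', hk', hk⟩ : ∃ e k', k' < a3 ∧ k + c * d = a3 * e + k' :=
    ⟨(k + c * d) / a3, (k + c * d) % a3, Nat.mod_lt _ ha3, (Nat.div_add_mod _ _).symm⟩
  obtain ⟨f, j', hj', hj⟩ : ∃ f j', j' < a2 ∧ j + s * d + q * e = a2 * f + j' :=
    ⟨(j + s * d + q * e) / a2, (j + s * d + q * e) % a2, Nat.mod_lt _ ha2,
      (Nat.div_add_mod _ _).symm⟩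
  refine ⟨i + r * d + p * e + a1 * f, j', k', l', hj', hk', hl', ?_, ?_⟩
  · calc x ^ i * y ^ j * z ^ k * t ^ (a4 * d + l')
        = x ^ (i + r * d) * y ^ (j + s * d) * z ^ (k + c * d) * t ^ l' := by
          rw [pow_add t, pow_mul t, h3]; ring
      _ = x ^ (i + r * d + p * e) * y ^ (j + s * d + q * e) * z ^ k' * t ^ l' := by
          rw [hk, pow_add z, pow_mul z, h2]; ring
      _ = x ^ (i + r * d + p * e + a1 * f) * y ^ j' * z ^ k' * t ^ l' := by
          rw [hj, pow_add y, pow_mul y, ← h1]; ring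
  · zify at hk hj ⊢
    linear_combination (a1 * a3 * a4 : ℤ) * hj + (a4 * (a1 * q + p * a2) : ℤ) * hk

/-- Two naturals below `a` are equal as soon as their difference is annihilated modulo `a` by an
integer coprime to `a`. -/
theorem eq_of_dvd_mul_sub {a k k' : ℕ} {N : ℤ} (hk : k < a) (hk' : k' < a)
    (hN : IsCoprime (a : ℤ) N) (h : (a : ℤ) ∣ N * ((k : ℤ) - k')) : k = k' := by
  have := Int.eq_zero_of_abs_lt_dvd (hN.dvd_of_dvd_mul_left h) (by rw [abs_lt]; omega)
  omega

/-- Reduced monomials of the same weighted degree are equal. -/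
theorem reduced_monomial_unique {a1 a2 a3 a4 p q r s c : ℕ}
    (ha2 : 0 < a2) (ha3 : 0 < a3) (ha4 : 0 < a4)
    (hg : Nat.gcd (Nat.gcd (Nat.gcd (a2 * a3 * a4) (a1 * a3 * a4)) (a4 * (a1 * q + p * a2)))
      (c * (a1 * q + a2 * p) + a3 * (a1 * s + r * a2)) = 1)
    {i j k l i' j' k' l' : ℕ} (hj : j < a2) (hk : k < a3) (hl : l < a4)
    (hj' : j' < a2) (hk' : k' < a3) (hl' : l' < a4)
    (h : a2 * a3 * a4 * i + a1 * a3 * a4 * j + a4 * (a1 * q + p * a2) * k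
          + (c * (a1 * q + a2 * p) + a3 * (a1 * s + r * a2)) * l =
        a2 * a3 * a4 * i' + a1 * a3 * a4 * j' + a4 * (a1 * q + p * a2) * k'
          + (c * (a1 * q + a2 * p) + a3 * (a1 * s + r * a2)) * l') :
    i = i' ∧ j = j' ∧ k = k' ∧ l = l' := by
  have key : ∀ d : ℕ, d ∣ a2 * a3 * a4 → d ∣ a1 * a3 * a4 → d ∣ a4 * (a1 * q + p * a2) →
      d ∣ c * (a1 * q + a2 * p) + a3 * (a1 * s + r * a2) → d = 1 := fun d h0 h1 h2 h3 =>
    Nat.dvd_one.mp (hg ▸ Nat.dvd_gcd (Nat.dvd_gcd (Nat.dvd_gcd h0 h1) h2) h3)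
  have c4 : Nat.Coprime a4 (c * (a1 * q + a2 * p) + a3 * (a1 * s + r * a2)) := by
    have h4 := Nat.gcd_dvd_left a4 (c * (a1 * q + a2 * p) + a3 * (a1 * s + r * a2))
    exact key _ (h4.mul_left _) (h4.mul_left _) (h4.mul_right _) (Nat.gcd_dvd_right _ _)
  have c3 : Nat.Coprime a3 (a1 * q + p * a2) := by
    have h3 := Nat.gcd_dvd_left a3 (a1 * q + p * a2)
    have h3' := Nat.gcd_dvd_right a3 (a1 * q + p * a2)
    refine key _ ((h3.mul_left _).mul_right _) ((h3.mul_left _).mul_right _) (h3'.mul_left _)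
      (dvd_add (Dvd.dvd.mul_left ?_ _) (h3.mul_right _))
    rwa [mul_comm a2 p]
  have c2 : Nat.Coprime a2 a1 := by
    have h2 := Nat.gcd_dvd_left a2 a1
    have h1 := Nat.gcd_dvd_right a2 a1
    exact key _ ((h2.mul_right _).mul_right _) ((h1.mul_right _).mul_right _)
      ((dvd_add (h1.mul_right _) (h2.mul_left _)).mul_left _)
      (dvd_add ((dvd_add (h1.mul_right _) (h2.mul_right _)).mul_left _)
        ((dvd_add (h1.mul_right _) (h2.mul_left _)).mul_left _))
  zify at h
  obtain rfl : l = l' := by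
    refine eq_of_dvd_mul_sub hl hl' (Nat.isCoprime_iff_coprime.mpr c4)
      ⟨-(a2 * a3 * (i - i') + a1 * a3 * (j - j') + (a1 * q + p * a2) * (k - k')), ?_⟩
    push_cast
    linear_combination h
  have ha4' : (a4 : ℤ) ≠ 0 := by omega
  have ha3' : (a3 : ℤ) ≠ 0 := by omega
  have ha2' : (a2 : ℤ) ≠ 0 := by omega
  obtain rfl : k = k' := by
    refine eq_of_dvd_mul_sub hk hk' (Nat.isCoprime_iff_coprime.mpr c3)
      ⟨-(a2 * (i - i') + a1 * (j - j')), mul_left_cancel₀ ha4' ?_⟩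
    push_cast
    linear_combination h
  obtain rfl : j = j' := by
    refine eq_of_dvd_mul_sub hj hj' (Nat.isCoprime_iff_coprime.mpr c2)
      ⟨-(i - i'), mul_left_cancel₀ (mul_ne_zero ha3' ha4') ?_⟩
    linear_combination h
  refine ⟨?_, rfl, rfl, rfl⟩
  have : (i : ℤ) = i' := by
    refine mul_left_cancel₀ (mul_ne_zero (mul_ne_zero ha2' ha3') ha4') ?_
    linear_combination h
  exact_mod_cast this

theorem monomial_one_eq_fin_four {K : Type*} [Field K] (m : Fin 4 →₀ ℕ) :
    (monomial m 1 : MvPolynomial (Fin 4) K) = X 0 ^ m 0 * X 1 ^ m 1 * X 2 ^ m 2 * X 3 ^ m 3 := by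
  rw [monomial_eq, C_1, one_mul, Finsupp.prod_fintype _ _ (fun _ => pow_zero _),
    Fin.prod_univ_four]

/-- An ideal contains the toric ideal as soon as it identifies any two monomials of the same
weighted degree. -/
theorem toricIdeal_le {K : Type*} [Field K] {N : Fin 4 → ℕ}
    {J : Ideal (MvPolynomial (Fin 4) K)}
    (h : ∀ m m' : Fin 4 →₀ ℕ, ∑ i, N i * m i = ∑ i, N i * m' i →
      Ideal.Quotient.mk J (monomial m 1) = Ideal.Quotient.mk J (monomial m' 1)) :
    toricIdeal K N ≤ J := by
  classical
  let g : ℕ → MvPolynomial (Fin 4) K ⧸ J := fun d =>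
    if hd : ∃ m : Fin 4 →₀ ℕ, ∑ i, N i * m i = d then
      Ideal.Quotient.mk J (monomial hd.choose 1) else 0
  let σ : Polynomial K →ₗ[K] MvPolynomial (Fin 4) K ⧸ J :=
    (Polynomial.basisMonomials K).constr K g
  have hσ : ∀ d, σ (Polynomial.X ^ d) = g d := fun d => by
    rw [Polynomial.X_pow_eq_monomial,
      ← congr_fun (Polynomial.coe_basisMonomials (R := K)) d]
    exact (Polynomial.basisMonomials K).constr_basis K g d
  have hcomp : σ ∘ₗ (aeval fun i => (Polynomial.X : Polynomial K) ^ N i).toLinearMap =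
      (Ideal.Quotient.mkₐ K J).toLinearMap := by
    refine (basisMonomials (Fin 4) K).ext fun m => ?_
    have hm : ∃ m' : Fin 4 →₀ ℕ, ∑ i, N i * m' i = ∑ i, N i * m i := ⟨m, rfl⟩
    have ha : aeval (fun i => (Polynomial.X : Polynomial K) ^ N i) (monomial m (1 : K)) =
        Polynomial.X ^ ∑ i, N i * m i := by
      rw [aeval_monomial, map_one, one_mul, Finsupp.prod_fintype _ _ (fun _ => pow_zero _),
        ← Finset.prod_pow_eq_pow_sum]
      simp only [pow_mul]
    simp only [coe_basisMonomials, LinearMap.comp_apply, AlgHom.toLinearMap_apply, ha, hσ,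
      Ideal.Quotient.mkₐ_eq_mk]
    simp only [g, dif_pos hm]
    exact h _ _ hm.choose_spec
  intro f hf
  have hf0 : aeval (fun i => (Polynomial.X : Polynomial K) ^ N i) f = 0 := hf
  have := LinearMap.congr_fun hcomp f
  simp only [LinearMap.comp_apply, AlgHom.toLinearMap_apply, hf0, map_zero,
    Ideal.Quotient.mkₐ_eq_mk] at this
  exact Ideal.Quotient.eq_zero_iff_mem.mp this.symm

theorem toricIdeal_eq_span (K : Type*) [Field K] {a1 a2 a3 a4 p q r s c : ℕ}
    (ha2 : 0 < a2) (ha3 : 0 < a3) (ha4 : 0 < a4)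
    {N : Fin 4 → ℕ} (h0 : N 0 = a2 * a3 * a4) (h1 : N 1 = a1 * a3 * a4)
    (h2 : N 2 = a4 * (a1 * q + p * a2))
    (h3 : N 3 = c * (a1 * q + a2 * p) + a3 * (a1 * s + r * a2))
    (hg : Nat.gcd (Nat.gcd (Nat.gcd (N 0) (N 1)) (N 2)) (N 3) = 1) :
    toricIdeal K N = Ideal.span {(X 0 : MvPolynomial (Fin 4) K) ^ a1 - X 1 ^ a2,
      X 2 ^ a3 - X 0 ^ p * X 1 ^ q, X 3 ^ a4 - X 0 ^ r * X 1 ^ s * X 2 ^ c} := by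
  rw [h0, h1, h2, h3] at hg
  apply le_antisymm
  · set J := Ideal.span {(X 0 : MvPolynomial (Fin 4) K) ^ a1 - X 1 ^ a2,
      X 2 ^ a3 - X 0 ^ p * X 1 ^ q, X 3 ^ a4 - X 0 ^ r * X 1 ^ s * X 2 ^ c} with hJ
    refine toricIdeal_le fun m m' hmm => ?_
    have e1 : Ideal.Quotient.mk J (X 0) ^ a1 = Ideal.Quotient.mk J (X 1) ^ a2 := by
      rw [← map_pow, ← map_pow, Ideal.Quotient.eq]
      exact Ideal.subset_span (by simp)
    have e2 : Ideal.Quotient.mk J (X 2) ^ a3 =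
        Ideal.Quotient.mk J (X 0) ^ p * Ideal.Quotient.mk J (X 1) ^ q := by
      simp only [← map_pow, ← map_mul]
      rw [Ideal.Quotient.eq]
      exact Ideal.subset_span (by simp)
    have e3 : Ideal.Quotient.mk J (X 3) ^ a4 = Ideal.Quotient.mk J (X 0) ^ r *
        Ideal.Quotient.mk J (X 1) ^ s * Ideal.Quotient.mk J (X 2) ^ c := by
      simp only [← map_pow, ← map_mul]
      rw [Ideal.Quotient.eq]
      exact Ideal.subset_span (by simp)
    obtain ⟨i, j, k, l, hj, hk, hl, hm, hd⟩ :=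
      exists_reduced_monomial_s14 ha2 ha3 ha4 e1 e2 e3 (m 0) (m 1) (m 2) (m 3)
    obtain ⟨i', j', k', l', hj', hk', hl', hm', hd'⟩ :=
      exists_reduced_monomial_s14 ha2 ha3 ha4 e1 e2 e3 (m' 0) (m' 1) (m' 2) (m' 3)
    simp only [Fin.sum_univ_four, h0, h1, h2, h3] at hmm
    obtain ⟨rfl, rfl, rfl, rfl⟩ := reduced_monomial_unique ha2 ha3 ha4 hg hj hk hl hj' hk' hl'
      (hd.symm.trans (hmm.trans hd'))
    simp only [monomial_one_eq_fin_four, map_mul, map_pow]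
    rw [hm, hm']
  · rw [Ideal.span_le]
    rintro f (rfl | rfl | rfl) <;>
    · simp only [toricIdeal, SetLike.mem_coe, RingHom.mem_ker, map_sub, map_mul, map_pow, aeval_X,
        h0, h1, h2, h3]
      ring

theorem stmt14 (K : Type*) [Field K] (a1 a2 a3 a4 u1 u2 v1 v2 v3 : ℕ)
    (ha1 : 0 < a1) (ha2 : 0 < a2) (ha3 : 0 < a3) (ha4 : 0 < a4)
    (hu12 : ¬(u1 = 0 ∧ u2 = 0)) (hv123 : ¬(v1 = 0 ∧ v2 = 0 ∧ v3 = 0))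
    (n : Fin 4 → ℕ)
    (hn : n = ![a2 * a3 * a4, a1 * a3 * a4, a4 * (a1 * u2 + u1 * a2),
      v3 * (a1 * u2 + a2 * u1) + a3 * (a1 * v2 + v1 * a2)])
    (b : Fin 4 → ℕ)
    (hb : b = ![0, 0, a4 * (a1 + a2), v3 * (a1 + a2) + a3 * (a1 + a2)]) :
    ∀ w : ℕ, 0 < w →
      Nat.gcd (Nat.gcd (Nat.gcd (n 0 + w * b 0) (n 1 + w * b 1))
        (n 2 + w * b 2)) (n 3 + w * b 3) = 1 →
      toricIdeal K (fun j => n j + w * b j) =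
        Ideal.span {(X 0 : MvPolynomial (Fin 4) K) ^ a1 - X 1 ^ a2,
          X 2 ^ a3 - X 0 ^ (u1 + w) * X 1 ^ (u2 + w),
          X 3 ^ a4 - X 0 ^ (v1 + w) * X 1 ^ (v2 + w) * X 2 ^ v3} ∧
      ∃ g1 g2 g3 : MvPolynomial (Fin 4) K,
        toricIdeal K (fun j => n j + w * b j) = Ideal.span {g1, g2, g3} := by
  intro w _ hg
  have hspan := toricIdeal_eq_span K (N := fun j => n j + w * b j) (p := u1 + w) (q := u2 + w)
    (r := v1 + w) (s := v2 + w) (c := v3) (a1 := a1) ha2 ha3 ha4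
    (by simp [hn, hb]) (by simp [hn, hb])
    (by simp only [hn, hb, Matrix.cons_val]; ring)
    (by simp only [hn, hb, Matrix.cons_val]; ring) hg
  exact ⟨hspan, _, _, _, hspan⟩
end

section
/- Assume the Case (B) setup with gcd(n1,n2,n3,n4) = 1, and let d = (0, 0, a4(a1 + a2), v3(a1 + a2) + a3(a1 + a2)). Then there exists a nonnegative integer w1 such that for every integer w ≥ w1, if the four entries of n + w·d have greatest common divisor 1, then the ideal I(n + w·d)_* can be generated by 3 polynomials, i.e. it is a complete intersection. -/
open MvPolynomial

lemma aeval_X_pow_monomial_one {K : Type*} [Field K] (n : Fin 4 → ℕ) (α : Fin 4 →₀ ℕ) :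
    aeval (fun i => (Polynomial.X : Polynomial K) ^ n i) (monomial α (1 : K)) =
      Polynomial.X ^ (∑ i, n i * α i) := by
  rw [aeval_monomial, map_one, one_mul, Finsupp.prod_fintype _ _ (by simp),
    ← Finset.prod_pow_eq_pow_sum]
  simp [pow_mul]

/-- If every monomial is congruent modulo `J`, up to terms of larger degree, to the representative
`r` of its weight, then the lowest-degree components of elements of the toric ideal lie in `J`. -/
lemma homogeneousComponent_mem_of_representatives {K : Type*} [Field K] (n : Fin 4 → ℕ)
    (J : Ideal (MvPolynomial (Fin 4) K)) (r : ℕ → Fin 4 →₀ ℕ)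
    (hr : ∀ α : Fin 4 →₀ ℕ,
      (α.degree = (r (∑ i, n i * α i)).degree ∧
        monomial α (1 : K) - monomial (r (∑ i, n i * α i)) 1 ∈ J) ∨
      (α.degree < (r (∑ i, n i * α i)).degree ∧ monomial α (1 : K) ∈ J))
    (f : MvPolynomial (Fin 4) K) (hf : f ∈ toricIdeal K n) (d : ℕ)
    (hd : ∀ e < d, homogeneousComponent e f = 0) :
    homogeneousComponent d f ∈ J := by
  let ψ : Polynomial K →ₗ[K] (MvPolynomial (Fin 4) K ⧸ J) :=
    (Polynomial.basisMonomials K).constr K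
      (fun W => if (r W).degree = d then Ideal.Quotient.mk J (monomial (r W) 1) else 0)
  have hψ : ∀ W, ψ (Polynomial.X ^ W) =
      if (r W).degree = d then Ideal.Quotient.mk J (monomial (r W) 1) else 0 := by
    intro W
    have h := (Polynomial.basisMonomials K).constr_basis K
      (fun W => if (r W).degree = d then Ideal.Quotient.mk J (monomial (r W) (1 : K)) else 0) W
    rw [Polynomial.coe_basisMonomials] at h
    rw [← Polynomial.monomial_one_right_eq_X_pow]
    exact h
  let π : MvPolynomial (Fin 4) K →ₐ[K] Polynomial K :=
    aeval (fun i => (Polynomial.X : Polynomial K) ^ n i)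
  have hπ : ∀ α : Fin 4 →₀ ℕ, π (monomial α 1) = Polynomial.X ^ (∑ i, n i * α i) :=
    aeval_X_pow_monomial_one n
  let L : MvPolynomial (Fin 4) K →ₗ[K] (MvPolynomial (Fin 4) K ⧸ J) :=
    (Ideal.Quotient.mkₐ K J).toLinearMap ∘ₗ homogeneousComponent d - ψ ∘ₗ π.toLinearMap
  have hL : ∀ α : Fin 4 →₀ ℕ, d ≤ α.degree → L (monomial α 1) = 0 := by
    intro α hα
    have e : L (monomial α 1) = Ideal.Quotient.mk J (homogeneousComponent d (monomial α 1))
        - ψ (Polynomial.X ^ (∑ i, n i * α i)) := by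
      rw [← hπ]; rfl
    rw [e, hψ, homogeneousComponent_of_mem (isHomogeneous_monomial (1 : K) rfl)]
    rcases hr α with ⟨h1, h2⟩ | ⟨h1, h2⟩
    · by_cases h : d = α.degree
      · rw [if_pos h, if_pos (by omega), ← map_sub]
        exact Ideal.Quotient.eq_zero_iff_mem.2 h2
      · rw [if_neg h, if_neg (by omega)]; simp
    · rw [if_neg (c := (r _).degree = d) (by omega), sub_zero]
      split_ifs
      · exact Ideal.Quotient.eq_zero_iff_mem.2 h2
      · simp
  have hLf : L f = 0 := by
    conv_lhs => rw [f.as_sum]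
    rw [map_sum]
    refine Finset.sum_eq_zero fun α hα => ?_
    have hle : d ≤ α.degree := by
      by_contra hlt
      have h := congrArg (coeff α) (hd _ (not_le.1 hlt))
      rw [coeff_homogeneousComponent, if_pos rfl, coeff_zero] at h
      exact (mem_support_iff.1 hα) h
    rw [show monomial α (coeff α f) = coeff α f • monomial α (1 : K) by
      rw [smul_monomial, smul_eq_mul, mul_one], map_smul, hL α hle, smul_zero]
  have hπf : π f = 0 := hf
  have e : L f = Ideal.Quotient.mk J (homogeneousComponent d f) - ψ (π f) := rfl
  rw [e, hπf, map_zero, sub_zero] at hLf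
  exact Ideal.Quotient.eq_zero_iff_mem.1 hLf

lemma homogeneousComponent_mem_idealStar {K : Type*} [Field K]
    {I : Ideal (MvPolynomial (Fin 4) K)} {f : MvPolynomial (Fin 4) K} (hf : f ∈ I) (d : ℕ)
    (hd : ∀ e < d, homogeneousComponent e f = 0) :
    homogeneousComponent d f ∈ idealStar I := by
  by_cases h : homogeneousComponent d f = 0
  · rw [h]; exact zero_mem _
  · refine Ideal.subset_span ⟨f, hf, ?_, d, hd, h, rfl⟩
    rintro rfl
    exact h (map_zero _)

lemma mem_idealStar_of_isHomogeneous {K : Type*} [Field K]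
    {I : Ideal (MvPolynomial (Fin 4) K)} {f : MvPolynomial (Fin 4) K} {d : ℕ} (hf : f ∈ I)
    (h : f.IsHomogeneous d) : f ∈ idealStar I := by
  have := homogeneousComponent_mem_idealStar hf d fun e he => by
    rw [homogeneousComponent_of_mem h, if_neg he.ne]
  rwa [homogeneousComponent_of_mem h, if_pos rfl] at this

lemma mem_idealStar_of_sub_mem {K : Type*} [Field K]
    {I : Ideal (MvPolynomial (Fin 4) K)} {f g : MvPolynomial (Fin 4) K} {d d' : ℕ}
    (hf : f.IsHomogeneous d) (hg : g.IsHomogeneous d') (hdd : d < d') (h : f - g ∈ I) :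
    f ∈ idealStar I := by
  have := homogeneousComponent_mem_idealStar h d fun e he => by
    rw [map_sub, homogeneousComponent_of_mem hf, homogeneousComponent_of_mem hg,
      if_neg he.ne, if_neg (by omega), sub_zero]
  rwa [map_sub, homogeneousComponent_of_mem hf, homogeneousComponent_of_mem hg,
    if_pos rfl, if_neg hdd.ne, sub_zero] at this

/-- Monomials of the gluing semigroup in normal form are determined by their weight. -/
lemma normalForm_unique {a1 a2 a3 a4 C N : ℕ} (ha1 : 0 < a1) (ha3 : 0 < a3) (ha4 : 0 < a4)
    (h12 : Nat.Coprime a1 a2) (h3 : Nat.Coprime a3 C) (h4 : Nat.Coprime a4 N)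
    {i b j k i' b' j' k' : ℕ} (hi : i < a1) (hj : j < a3) (hk : k < a4)
    (hi' : i' < a1) (hj' : j' < a3) (hk' : k' < a4)
    (h : a2 * a3 * a4 * i + a1 * a3 * a4 * b + a4 * C * j + N * k =
      a2 * a3 * a4 * i' + a1 * a3 * a4 * b' + a4 * C * j' + N * k') :
    i = i' ∧ b = b' ∧ j = j' ∧ k = k' := by
  have key : ∀ {a c x y s t : ℕ}, Nat.Coprime a c → x < a → y < a →
      a * s + c * x = a * t + c * y → x = y := by
    intro a c x y s t hac hx hy hst
    have h1 : c * x ≡ c * y [MOD a] := by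
      have := congrArg (· % a) hst
      simpa [Nat.ModEq, Nat.add_mod] using this
    exact (Nat.ModEq.cancel_left_of_coprime hac h1).eq_of_lt_of_lt hx hy
  obtain rfl : k = k' := key (s := a2 * a3 * i + a1 * a3 * b + C * j)
    (t := a2 * a3 * i' + a1 * a3 * b' + C * j') h4 hk hk' (by linarith)
  have e1 : a3 * (a2 * i + a1 * b) + C * j = a3 * (a2 * i' + a1 * b') + C * j' :=
    Nat.eq_of_mul_eq_mul_left ha4 (by linarith)
  obtain rfl : j = j' := key h3 hj hj' e1
  have e2 : a1 * b + a2 * i = a1 * b' + a2 * i' :=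
    Nat.eq_of_mul_eq_mul_left ha3 (by linarith)
  obtain rfl : i = i' := key h12 hi hi' e2
  exact ⟨rfl, Nat.eq_of_mul_eq_mul_left ha1 (by linarith), rfl, rfl⟩

/-- Two monomials of equal weight, the second being a rewriting of the first modulo `J` up to
terms of larger degree. -/
def DegreeRewrites {K : Type*} [Field K] (n : Fin 4 → ℕ) (J : Ideal (MvPolynomial (Fin 4) K))
    (α β : Fin 4 →₀ ℕ) : Prop :=
  ∑ i, n i * α i = ∑ i, n i * β i ∧
    ((α.degree = β.degree ∧ monomial α (1 : K) - monomial β 1 ∈ J) ∨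
      (α.degree < β.degree ∧ monomial α (1 : K) ∈ J))

namespace DegreeRewrites

variable {K : Type*} [Field K] {n : Fin 4 → ℕ} {J : Ideal (MvPolynomial (Fin 4) K)}
  {α β γ : Fin 4 →₀ ℕ}

lemma refl (α : Fin 4 →₀ ℕ) : DegreeRewrites n J α α :=
  ⟨rfl, Or.inl ⟨rfl, by simp⟩⟩

lemma trans (h : DegreeRewrites n J α β) (h' : DegreeRewrites n J β γ) :
    DegreeRewrites n J α γ := by
  obtain ⟨w, ⟨d, m⟩ | ⟨d, m⟩⟩ := h <;> obtain ⟨w', ⟨d', m'⟩ | ⟨d', m'⟩⟩ := h'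
  · exact ⟨w.trans w', Or.inl ⟨d.trans d', by simpa using J.add_mem m m'⟩⟩
  · exact ⟨w.trans w', Or.inr ⟨by omega, by simpa using J.add_mem m m'⟩⟩
  · exact ⟨w.trans w', Or.inr ⟨by omega, m⟩⟩
  · exact ⟨w.trans w', Or.inr ⟨by omega, m⟩⟩

lemma add_right (h : DegreeRewrites n J α β) (δ : Fin 4 →₀ ℕ) :
    DegreeRewrites n J (α + δ) (β + δ) := by
  obtain ⟨w, h⟩ := h
  refine ⟨by simp only [Finsupp.add_apply, mul_add, Finset.sum_add_distrib, w], ?_⟩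
  have e : ∀ ε : Fin 4 →₀ ℕ, monomial (ε + δ) (1 : K) = monomial ε 1 * monomial δ 1 := by
    intro ε; rw [monomial_mul, one_mul]
  simp only [map_add, e, ← sub_mul]
  rcases h with ⟨d, m⟩ | ⟨d, m⟩
  · exact Or.inl ⟨by omega, J.mul_mem_right _ m⟩
  · exact Or.inr ⟨by omega, J.mul_mem_right _ m⟩

/-- A rewriting rule lowering the exponent of `x s` by `a` can be applied until that exponent
is less than `a`, without raising the exponents untouched by its right-hand side. -/
lemma exists_exponent_lt {s : Fin 4} {a : ℕ} (ha : 0 < a)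
    (h : DegreeRewrites n J (Finsupp.single s a) β) (hβ : β s = 0) (α : Fin 4 →₀ ℕ) :
    ∃ γ, DegreeRewrites n J α γ ∧ γ s < a ∧ ∀ t, t ≠ s → β t = 0 → γ t = α t := by
  induction hm : α s using Nat.strong_induction_on generalizing α with
  | _ m ih =>
    by_cases hlt : α s < a
    · exact ⟨α, refl α, hlt, fun _ _ _ => rfl⟩
    · have hle : Finsupp.single s a ≤ α := by
        rw [Finsupp.single_le_iff]; omega
      have step := h.add_right (α - Finsupp.single s a)
      rw [add_tsub_cancel_of_le hle] at step
      have hs : (β + (α - Finsupp.single s a)) s = α s - a := by simp [hβ]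
      obtain ⟨γ, h1, h2, h3⟩ := ih _ (by omega) (β + (α - Finsupp.single s a)) hs
      refine ⟨γ, step.trans h1, h2, fun t ht hβt => ?_⟩
      rw [h3 t ht hβt]
      simp [hβt, ht.symm]

end DegreeRewrites

lemma monomial_sub_mem_toricIdeal {K : Type*} [Field K] {n : Fin 4 → ℕ} {α β : Fin 4 →₀ ℕ}
    (h : ∑ i, n i * α i = ∑ i, n i * β i) :
    monomial α (1 : K) - monomial β 1 ∈ toricIdeal K n := by
  rw [toricIdeal, RingHom.mem_ker, map_sub]
  exact sub_eq_zero.2 ((aeval_X_pow_monomial_one n α).trans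
    ((congrArg _ h).trans (aeval_X_pow_monomial_one n β).symm))

/-- The initial ideal of a glued monomial curve all of whose gluing binomials but the first
are dominated by the pure power. -/
lemma idealStar_toricIdeal_of_gluing {K : Type*} [Field K] {n : Fin 4 → ℕ} {p q : Fin 4}
    (hpq : (p = 0 ∧ q = 1) ∨ (p = 1 ∧ q = 0)) {a1 a2 a3 a4 U1 U2 V1 V2 v3 : ℕ}
    (ha1 : 0 < a1) (ha3 : 0 < a3) (ha4 : 0 < a4) (ha12 : a1 ≤ a2)
    (hU : a3 < U1 + U2) (hV : a4 < V1 + V2 + v3)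
    (hp : n p = a2 * a3 * a4) (hq : n q = a1 * a3 * a4)
    (h2 : n 2 = a4 * (a1 * U2 + a2 * U1))
    (h3 : n 3 = v3 * (a1 * U2 + a2 * U1) + a3 * (a1 * V2 + a2 * V1))
    (c12 : Nat.Coprime a1 a2) (c3 : Nat.Coprime a3 (a1 * U2 + a2 * U1))
    (c4 : Nat.Coprime a4 (n 3)) :
    ∃ g1 g2 g3 : MvPolynomial (Fin 4) K,
      idealStar (toricIdeal K n) = Ideal.span {g1, g2, g3} := by
  obtain ⟨g1, hg1, hg1'⟩ : ∃ g1 : MvPolynomial (Fin 4) K, g1 ∈ idealStar (toricIdeal K n) ∧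
      ∀ J : Ideal (MvPolynomial (Fin 4) K), g1 ∈ J →
        DegreeRewrites n J (Finsupp.single p a1) (Finsupp.single q a2) := by
    have hw : ∑ i, n i * Finsupp.single p a1 i = ∑ i, n i * Finsupp.single q a2 i := by
      simp only [Finsupp.single_apply, mul_ite, mul_zero, Finset.sum_ite_eq, Finset.mem_univ,
        if_true, hp, hq]
      ring
    have hd : ∀ s a, (Finsupp.single (s : Fin 4) (a : ℕ)).degree = a := by simp
    rcases ha12.lt_or_eq with hlt | rfl
    · refine ⟨monomial (Finsupp.single p a1) 1, ?_, fun J hJ => ⟨hw, Or.inr ⟨by simpa, hJ⟩⟩⟩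
      exact mem_idealStar_of_sub_mem (isHomogeneous_monomial _ (hd p a1))
        (isHomogeneous_monomial _ (hd q a2)) hlt (monomial_sub_mem_toricIdeal hw)
    · refine ⟨monomial (Finsupp.single p a1) 1 - monomial (Finsupp.single q a1) 1, ?_,
        fun J hJ => ⟨hw, Or.inl ⟨by simp, hJ⟩⟩⟩
      exact mem_idealStar_of_isHomogeneous (monomial_sub_mem_toricIdeal hw)
        ((isHomogeneous_monomial _ (hd p a1)).sub (isHomogeneous_monomial _ (hd q a1)))
  set β₂ : Fin 4 →₀ ℕ := Finsupp.single p U1 + Finsupp.single q U2 with hβ₂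
  set β₃ : Fin 4 →₀ ℕ := Finsupp.single p V1 + Finsupp.single q V2 + Finsupp.single 2 v3 with hβ₃
  have hd2 : β₂.degree = U1 + U2 := by simp [hβ₂]
  have hd3 : β₃.degree = V1 + V2 + v3 := by simp [hβ₃]
  have hw2 : ∑ i, n i * Finsupp.single 2 a3 i = ∑ i, n i * β₂ i := by
    simp only [hβ₂, Finsupp.add_apply, mul_add, Finset.sum_add_distrib, Finsupp.single_apply,
      mul_ite, mul_zero, Finset.sum_ite_eq, Finset.mem_univ, if_true, hp, hq, h2]
    ring
  have hw3 : ∑ i, n i * Finsupp.single 3 a4 i = ∑ i, n i * β₃ i := by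
    simp only [hβ₃, Finsupp.add_apply, mul_add, Finset.sum_add_distrib, Finsupp.single_apply,
      mul_ite, mul_zero, Finset.sum_ite_eq, Finset.mem_univ, if_true, hp, hq, h2, h3]
    ring
  have hg2 : monomial (Finsupp.single 2 a3) (1 : K) ∈ idealStar (toricIdeal K n) :=
    mem_idealStar_of_sub_mem (isHomogeneous_monomial _ (by simp))
      (isHomogeneous_monomial _ hd2) hU (monomial_sub_mem_toricIdeal hw2)
  have hg3 : monomial (Finsupp.single 3 a4) (1 : K) ∈ idealStar (toricIdeal K n) :=
    mem_idealStar_of_sub_mem (isHomogeneous_monomial _ (by simp))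
      (isHomogeneous_monomial _ hd3) hV (monomial_sub_mem_toricIdeal hw3)
  refine ⟨g1, monomial (Finsupp.single 2 a3) 1, monomial (Finsupp.single 3 a4) 1,
    le_antisymm ?_ ?_⟩
  · set J : Ideal (MvPolynomial (Fin 4) K) :=
      Ideal.span {g1, monomial (Finsupp.single 2 a3) 1, monomial (Finsupp.single 3 a4) 1}
    have r1 := hg1' J (Ideal.subset_span (by simp))
    have r2 : DegreeRewrites n J (Finsupp.single 2 a3) β₂ :=
      ⟨hw2, Or.inr ⟨by rw [hd2]; simpa, Ideal.subset_span (by simp)⟩⟩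
    have r3 : DegreeRewrites n J (Finsupp.single 3 a4) β₃ :=
      ⟨hw3, Or.inr ⟨by rw [hd3]; simpa, Ideal.subset_span (by simp)⟩⟩
    have hex : ∀ α : Fin 4 →₀ ℕ, ∃ γ, DegreeRewrites n J α γ ∧ γ p < a1 ∧ γ 2 < a3 ∧
        γ 3 < a4 := by
      intro α
      obtain ⟨γ₁, s1, l1, -⟩ := r3.exists_exponent_lt ha4
        (by rcases hpq with ⟨rfl, rfl⟩ | ⟨rfl, rfl⟩ <;> simp [hβ₃]) α
      obtain ⟨γ₂, s2, l2, k2⟩ := r2.exists_exponent_lt ha3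
        (by rcases hpq with ⟨rfl, rfl⟩ | ⟨rfl, rfl⟩ <;> simp [hβ₂]) γ₁
      obtain ⟨γ₃, s3, l3, k3⟩ := r1.exists_exponent_lt ha1
        (by rcases hpq with ⟨rfl, rfl⟩ | ⟨rfl, rfl⟩ <;> simp) γ₂
      refine ⟨γ₃, (s1.trans s2).trans s3, l3, ?_, ?_⟩
      · rw [k3 2] <;> rcases hpq with ⟨rfl, rfl⟩ | ⟨rfl, rfl⟩ <;> simp [l2]
      · rw [k3 3, k2 3] <;> rcases hpq with ⟨rfl, rfl⟩ | ⟨rfl, rfl⟩ <;> simp [l1, hβ₂]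
    have hsum : ∀ γ : Fin 4 →₀ ℕ, ∑ i, n i * γ i = a2 * a3 * a4 * γ p + a1 * a3 * a4 * γ q +
        a4 * (a1 * U2 + a2 * U1) * γ 2 + n 3 * γ 3 := by
      intro γ
      rw [Fin.sum_univ_four, ← hp, ← hq, ← h2]
      rcases hpq with ⟨rfl, rfl⟩ | ⟨rfl, rfl⟩ <;> ring
    have huniq : ∀ γ γ' : Fin 4 →₀ ℕ, γ p < a1 → γ 2 < a3 → γ 3 < a4 →
        γ' p < a1 → γ' 2 < a3 → γ' 3 < a4 → ∑ i, n i * γ i = ∑ i, n i * γ' i → γ = γ' := by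
      intro γ γ' l1 l2 l3 l1' l2' l3' h
      rw [hsum, hsum] at h
      obtain ⟨e1, e2, e3, e4⟩ := normalForm_unique ha1 ha3 ha4 c12 c3 c4 l1 l2 l3 l1' l2' l3' h
      ext t
      rcases hpq with ⟨rfl, rfl⟩ | ⟨rfl, rfl⟩ <;> fin_cases t <;> assumption
    choose ν hν l1 l2 l3 using hex
    let r : ℕ → Fin 4 →₀ ℕ :=
      fun W => ν (Function.invFun (fun α : Fin 4 →₀ ℕ => ∑ i, n i * α i) W)
    have hr : ∀ α, r (∑ i, n i * α i) = ν α := by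
      intro α
      refine huniq _ _ (l1 _) (l2 _) (l3 _) (l1 _) (l2 _) (l3 _) ?_
      rw [← (hν _).1, ← (hν _).1]
      exact Function.invFun_eq (f := fun α : Fin 4 →₀ ℕ => ∑ i, n i * α i) ⟨α, rfl⟩
    rw [idealStar, Ideal.span_le]
    rintro _ ⟨f, hf, -, d, hd, -, rfl⟩
    refine homogeneousComponent_mem_of_representatives n J r (fun α => ?_) f hf d hd
    rw [hr]
    exact (hν α).2
  · rw [Ideal.span_le]
    rintro _ (rfl | rfl | rfl)
    exacts [hg1, hg2, hg3]

theorem stmt15 (K : Type*) [Field K] (a1 a2 a3 a4 u1 u2 v1 v2 v3 : ℕ)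
    (ha1 : 0 < a1) (ha2 : 0 < a2) (ha3 : 0 < a3) (ha4 : 0 < a4)
    (hu12 : ¬(u1 = 0 ∧ u2 = 0)) (hv123 : ¬(v1 = 0 ∧ v2 = 0 ∧ v3 = 0))
    (n : Fin 4 → ℕ)
    (hn : n = ![a2 * a3 * a4, a1 * a3 * a4, a4 * (a1 * u2 + u1 * a2),
      v3 * (a1 * u2 + a2 * u1) + a3 * (a1 * v2 + v1 * a2)])
    (hgcd : Nat.gcd (Nat.gcd (Nat.gcd (n 0) (n 1)) (n 2)) (n 3) = 1)
    (d : Fin 4 → ℕ)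
    (hd : d = ![0, 0, a4 * (a1 + a2), v3 * (a1 + a2) + a3 * (a1 + a2)]) :
    ∃ w1 : ℕ, ∀ w : ℕ, w1 ≤ w →
      Nat.gcd (Nat.gcd (Nat.gcd (n 0 + w * d 0) (n 1 + w * d 1))
        (n 2 + w * d 2)) (n 3 + w * d 3) = 1 →
      ∃ g1 g2 g3 : MvPolynomial (Fin 4) K,
        idealStar (toricIdeal K (fun j => n j + w * d j)) = Ideal.span {g1, g2, g3} := by
  refine ⟨a3 + a4, fun w hw hgcdw => ?_⟩
  set m : Fin 4 → ℕ := fun j => n j + w * d j with hm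
  have m0 : m 0 = a2 * a3 * a4 := by simp [hm, hn, hd]
  have m1 : m 1 = a1 * a3 * a4 := by simp [hm, hn, hd]
  have m2 : m 2 = a4 * (a1 * (u2 + w) + a2 * (u1 + w)) := by
    simp [hm, hn, hd]; ring
  have m3 : m 3 = v3 * (a1 * (u2 + w) + a2 * (u1 + w)) +
      a3 * (a1 * (v2 + w) + a2 * (v1 + w)) := by
    simp [hm, hn, hd]; ring
  have hunit : ∀ g, g ∣ m 0 → g ∣ m 1 → g ∣ m 2 → g ∣ m 3 → g = 1 := by
    intro g h0 h1 h2 h3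
    exact Nat.dvd_one.1 (hgcdw ▸ Nat.dvd_gcd (Nat.dvd_gcd (Nat.dvd_gcd h0 h1) h2) h3)
  have c12 : Nat.Coprime a1 a2 := by
    have d1 := Nat.gcd_dvd_left a1 a2
    have d2 := Nat.gcd_dvd_right a1 a2
    have dl : ∀ x y, Nat.gcd a1 a2 ∣ a1 * x + a2 * y := fun x y =>
      dvd_add (d1.mul_right _) (d2.mul_right _)
    apply hunit
    · rw [m0]; exact (d2.mul_right _).mul_right _
    · rw [m1]; exact (d1.mul_right _).mul_right _
    · rw [m2]; exact (dl _ _).mul_left _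
    · rw [m3]; exact dvd_add ((dl _ _).mul_left _) ((dl _ _).mul_left _)
  have c3 : Nat.Coprime a3 (a1 * (u2 + w) + a2 * (u1 + w)) := by
    have d1 := Nat.gcd_dvd_left a3 (a1 * (u2 + w) + a2 * (u1 + w))
    have d2 := Nat.gcd_dvd_right a3 (a1 * (u2 + w) + a2 * (u1 + w))
    apply hunit
    · rw [m0]; exact (d1.mul_left _).mul_right _
    · rw [m1]; exact (d1.mul_left _).mul_right _
    · rw [m2]; exact d2.mul_left _
    · rw [m3]; exact dvd_add (d2.mul_left _) (d1.mul_right _)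
  have c4 : Nat.Coprime a4 (m 3) := by
    have d1 := Nat.gcd_dvd_left a4 (m 3)
    apply hunit
    · rw [m0]; exact d1.mul_left _
    · rw [m1]; exact d1.mul_left _
    · rw [m2]; exact d1.mul_right _
    · exact Nat.gcd_dvd_right _ _
  rcases le_total a1 a2 with h | h
  · exact idealStar_toricIdeal_of_gluing (Or.inl ⟨rfl, rfl⟩) ha1 ha3 ha4 h
      (by omega) (by omega) m0 m1 m2 m3 c12 c3 c4
  · refine idealStar_toricIdeal_of_gluing (Or.inr ⟨rfl, rfl⟩) (U1 := u2 + w) (U2 := u1 + w)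
      (V1 := v2 + w) (V2 := v1 + w) (v3 := v3) ha2 ha3 ha4 h
      (by omega) (by omega) m1 m0 ?_ ?_ c12.symm ?_ c4
    · rw [m2, add_comm (a1 * (u2 + w))]
    · rw [m3, add_comm (a1 * (u2 + w)), add_comm (a1 * (v2 + w))]
    · rwa [add_comm]
end
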